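/- arXiv:2112.12374 — 2 statements merged into one kernel-verified Lean document; each statement's English description precedes it below -/
import Mathlib

section
/- Let m ∈ ℕ with m ≥ 2, let d > 2m, set α = d - 2m, and let K(x) = |x|^{-α} (so α is a positive integer with α ≡ d mod 2 and α < d-2). There exists a constant C > 0 depending only on d and m such that for every μ ∈ C_c^∞(ℝ^d;ℝ) and every u ∈ C_c^∞(ℝ^d;ℝ^d), T(μ,u) ≤ C ( ‖∇u‖_{L^∞} + ‖∇^m u‖_{L^{d/(m-1)}} ) E(μ), i.e. ∬ μ(x) μ(y) u(x)·∇K(x-y) dx dy ≤ C ( ‖∇u‖_{L^∞} + ‖∇^m u‖_{L^{d/(m-1)}} ) ∬ μ(x) μ(y) |x-y|^{-α} dx dy. -/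
open MeasureTheory

noncomputable section

/-- The `L^p(ℝ^d)` norm of the `k`-th iterated derivative of `u : ℝ^d → ℝ^d`. -/
noncomputable def sobSeminorm (d : ℕ) (k : ℕ) (p : ℝ)
    (u : EuclideanSpace ℝ (Fin d) → EuclideanSpace ℝ (Fin d)) : ℝ :=
  (∫ x, ‖iteratedFDeriv ℝ k u x‖ ^ p) ^ p⁻¹

/-- The partial derivative `∂ᵢ f`. -/
def pd {d : ℕ} (i : Fin d) (f : EuclideanSpace ℝ (Fin d) → ℝ) : EuclideanSpace ℝ (Fin d) → ℝ :=
  fun x => fderiv ℝ f x (EuclideanSpace.single i 1)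

/-- The iterated partial derivative along a list of indices. -/
def dL {d : ℕ} : List (Fin d) → (EuclideanSpace ℝ (Fin d) → ℝ) → EuclideanSpace ℝ (Fin d) → ℝ
  | [], f => f
  | i :: L, f => pd i (dL L f)

/-- The nonnegative Laplacian `-Δ`. -/
def lap {d : ℕ} (f : EuclideanSpace ℝ (Fin d) → ℝ) : EuclideanSpace ℝ (Fin d) → ℝ :=
  fun x => -∑ i, pd i (pd i f) x

section Calculus

variable {d : ℕ} {f g : EuclideanSpace ℝ (Fin d) → ℝ}

lemma ContDiff.pd (hf : ContDiff ℝ (⊤ : ℕ∞) f) (i : Fin d) : ContDiff ℝ (⊤ : ℕ∞) (pd i f) := by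
  have h : ContDiff ℝ (⊤ : ℕ∞) (fderiv ℝ f) := hf.fderiv_right (m := (⊤ : ℕ∞)) (by simp)
  exact h.clm_apply contDiff_const

lemma ContDiff.dL (hf : ContDiff ℝ (⊤ : ℕ∞) f) (L : List (Fin d)) :
    ContDiff ℝ (⊤ : ℕ∞) (dL L f) := by
  induction L with
  | nil => exact hf
  | cons i L ih => exact ih.pd i

lemma ContDiff.lap (hf : ContDiff ℝ (⊤ : ℕ∞) f) : ContDiff ℝ (⊤ : ℕ∞) (lap f) :=
  (ContDiff.sum fun i _ => (hf.pd i).pd i).neg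

lemma ContDiff.iterate_lap (hf : ContDiff ℝ (⊤ : ℕ∞) f) (k : ℕ) :
    ContDiff ℝ (⊤ : ℕ∞) (_root_.lap^[k] f) := by
  induction k generalizing f with
  | zero => exact hf
  | succ k ih => exact ih hf.lap

lemma ContDiff.differentiable_of_top (hf : ContDiff ℝ (⊤ : ℕ∞) f) : Differentiable ℝ f :=
  hf.differentiable (by simp)

lemma HasCompactSupport.pd (hf : HasCompactSupport f) (i : Fin d) :
    HasCompactSupport (pd i f) :=
  hf.fderiv_apply ℝ _

lemma HasCompactSupport.dL (hf : HasCompactSupport f) (L : List (Fin d)) :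
    HasCompactSupport (dL L f) := by
  induction L with
  | nil => exact hf
  | cons i L ih => exact ih.pd i

lemma HasCompactSupport.lap (hf : HasCompactSupport f) : HasCompactSupport (lap f) := by
  refine HasCompactSupport.intro hf (fun x hx => ?_)
  have h : ∀ i, _root_.pd i (_root_.pd i f) x = 0 := fun i => by
    apply image_eq_zero_of_notMem_tsupport
    intro h
    exact hx (tsupport_fderiv_apply_subset ℝ _ (tsupport_fderiv_apply_subset ℝ _ h))
  simp [_root_.lap, h]

lemma HasCompactSupport.iterate_lap (hf : HasCompactSupport f) (k : ℕ) :
    HasCompactSupport (_root_.lap^[k] f) := by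
  induction k generalizing f with
  | zero => exact hf
  | succ k ih => exact ih hf.lap

lemma Filter.EventuallyEq.pd {x : EuclideanSpace ℝ (Fin d)} (h : f =ᶠ[nhds x] g) (i : Fin d) :
    pd i f =ᶠ[nhds x] pd i g :=
  h.fderiv.fun_comp (fun T : EuclideanSpace ℝ (Fin d) →L[ℝ] ℝ => T (EuclideanSpace.single i 1))

lemma Filter.EventuallyEq.dL {x : EuclideanSpace ℝ (Fin d)} (h : f =ᶠ[nhds x] g)
    (L : List (Fin d)) : dL L f =ᶠ[nhds x] dL L g := by
  induction L with
  | nil => exact h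
  | cons i L ih => exact ih.pd i

lemma Filter.EventuallyEq.lap {x : EuclideanSpace ℝ (Fin d)} (h : f =ᶠ[nhds x] g) :
    lap f =ᶠ[nhds x] lap g := by
  have := (Filter.eventually_all.2 fun i => (h.pd i).pd i)
  filter_upwards [this] with y hy
  simp [_root_.lap, hy]

lemma Filter.EventuallyEq.iterate_lap {x : EuclideanSpace ℝ (Fin d)} (h : f =ᶠ[nhds x] g)
    (k : ℕ) : _root_.lap^[k] f =ᶠ[nhds x] _root_.lap^[k] g := by
  induction k generalizing f g with
  | zero => exact h
  | succ k ih => exact ih h.lap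

lemma pd_mul (hf : Differentiable ℝ f) (hg : Differentiable ℝ g) (i : Fin d) :
    pd i (fun x => f x * g x) = fun x => f x * pd i g x + pd i f x * g x := by
  funext x
  have := fderiv_fun_mul (hf x) (hg x)
  simp only [pd, this]
  simp [mul_comm]

lemma pd_add (hf : Differentiable ℝ f) (hg : Differentiable ℝ g) (i : Fin d) :
    pd i (fun x => f x + g x) = fun x => pd i f x + pd i g x := by
  funext x
  simp only [pd, fderiv_fun_add (hf x) (hg x)]
  simp

lemma pd_neg (i : Fin d) : pd i (fun x => - f x) = fun x => - pd i f x := by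
  funext x
  simp only [pd, fderiv_fun_neg]
  simp

lemma pd_const_mul (hf : Differentiable ℝ f) (c : ℝ) (i : Fin d) :
    pd i (fun x => c * f x) = fun x => c * pd i f x := by
  funext x
  simp only [pd, fderiv_const_mul (hf x)]
  simp

lemma pd_sum {ι : Type*} {s : Finset ι} {F : ι → EuclideanSpace ℝ (Fin d) → ℝ}
    (hF : ∀ j, Differentiable ℝ (F j)) (i : Fin d) :
    pd i (fun x => ∑ j ∈ s, F j x) = fun x => ∑ j ∈ s, pd i (F j) x := by
  funext x
  simp only [pd, fderiv_fun_sum (fun j _ => hF j x)]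
  simp

lemma pd_list_sum {ι : Type*} (P : List ι) {F : ι → EuclideanSpace ℝ (Fin d) → ℝ}
    (hF : ∀ j, Differentiable ℝ (F j)) (i : Fin d) :
    Differentiable ℝ (fun x => (P.map fun j => F j x).sum) ∧
    pd i (fun x => (P.map fun j => F j x).sum) = fun x => (P.map fun j => pd i (F j) x).sum := by
  induction P with
  | nil => exact ⟨by simp, by funext x; simp [pd]⟩
  | cons a P ih =>
    simp only [List.map_cons, List.sum_cons]
    refine ⟨(hF a).add ih.1, ?_⟩
    rw [pd_add (hF a) ih.1, ih.2]

lemma pd_comm (hf : ContDiff ℝ (⊤ : ℕ∞) f) (i j : Fin d) : pd i (pd j f) = pd j (pd i f) := by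
  funext x
  have h : Differentiable ℝ (fderiv ℝ f) :=
    (hf.fderiv_right (m := (⊤ : ℕ∞)) (by simp)).differentiable (by simp)
  have hs : IsSymmSndFDerivAt ℝ f x := hf.contDiffAt.isSymmSndFDerivAt (by
    simpa using (mod_cast le_top : ((2 : ℕ∞) : WithTop ℕ∞) ≤ ((⊤ : ℕ∞) : WithTop ℕ∞)))
  have key : ∀ v w : EuclideanSpace ℝ (Fin d),
      fderiv ℝ (fun y => fderiv ℝ f y v) x w = fderiv ℝ (fderiv ℝ f) x w v := fun v w => by
    rw [fderiv_clm_apply (h x) (differentiableAt_const v)]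
    simp
  exact (key _ _).trans ((hs _ _).trans (key _ _).symm)

lemma dL_append (A B : List (Fin d)) : dL (A ++ B) f = dL A (dL B f) := by
  induction A with
  | nil => rfl
  | cons i A ih => simp only [List.cons_append, dL, ih]

lemma dL_pd (hf : ContDiff ℝ (⊤ : ℕ∞) f) (L : List (Fin d)) (i : Fin d) :
    dL L (pd i f) = pd i (dL L f) := by
  induction L with
  | nil => rfl
  | cons j L ih => simp only [dL, ih, pd_comm (hf.dL L)]

lemma dL_neg (L : List (Fin d)) : dL L (fun x => - f x) = fun x => - dL L f x := by
  induction L with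
  | nil => rfl
  | cons j L ih => simp only [dL, ih, pd_neg]

lemma dL_sum {ι : Type*} {s : Finset ι} {F : ι → EuclideanSpace ℝ (Fin d) → ℝ}
    (hF : ∀ j, ContDiff ℝ (⊤ : ℕ∞) (F j)) (L : List (Fin d)) :
    dL L (fun x => ∑ j ∈ s, F j x) = fun x => ∑ j ∈ s, dL L (F j) x := by
  induction L with
  | nil => rfl
  | cons j L ih => simp only [dL, ih, pd_sum (fun j => ((hF j).dL L).differentiable_of_top)]

lemma dL_lap (hf : ContDiff ℝ (⊤ : ℕ∞) f) (L : List (Fin d)) :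
    dL L (lap f) = fun x => -∑ i, dL (L ++ [i, i]) f x := by
  have : lap f = fun x => -(fun x => ∑ i, pd i (pd i f) x) x := rfl
  rw [this, dL_neg, dL_sum (fun i => (hf.pd i).pd i)]
  simp only [dL_append, dL]

lemma lap_dL (hf : ContDiff ℝ (⊤ : ℕ∞) f) (L : List (Fin d)) :
    lap (dL L f) = dL L (lap f) := by
  rw [dL_lap hf]
  funext x
  simp only [lap, dL_append, dL, dL_pd (hf.pd _), dL_pd hf]

lemma abs_iterate_lap_le (hf : ContDiff ℝ (⊤ : ℕ∞) f) (k : ℕ) (x : EuclideanSpace ℝ (Fin d))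
    {M : ℝ} (hM : ∀ L : List (Fin d), L.length = 2 * k → |dL L f x| ≤ M) :
    |lap^[k] f x| ≤ (d : ℝ) ^ k * M := by
  induction k generalizing f M with
  | zero => simpa [dL] using hM [] rfl
  | succ k ih =>
    rw [Function.iterate_succ_apply, pow_succ, mul_assoc]
    refine ih hf.lap fun L hL => ?_
    rw [dL_lap hf]
    simp only [abs_neg]
    refine (Finset.abs_sum_le_sum_abs _ _).trans ?_
    refine (Finset.sum_le_card_nsmul _ _ M fun i _ => hM _ (by simp [hL]; ring)).trans ?_
    simp

/-- Leibniz rule for iterated partial derivatives, with the undifferentiated first factor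
singled out. -/
lemma exists_leibniz (L : List (Fin d)) : ∃ P : List (List (Fin d) × List (Fin d)),
    (∀ q ∈ P, 1 ≤ q.1.length ∧ q.1.length + q.2.length = L.length) ∧
    ∀ f g : EuclideanSpace ℝ (Fin d) → ℝ, ContDiff ℝ (⊤ : ℕ∞) f → ContDiff ℝ (⊤ : ℕ∞) g →
      dL L (fun x => f x * g x) = fun x => f x * dL L g x +
        (P.map fun q => dL q.1 f x * dL q.2 g x).sum := by
  induction L with
  | nil => exact ⟨[], by simp, fun f g _ _ => by simp [dL]⟩
  | cons i L ih =>
    obtain ⟨P, hP, h⟩ := ih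
    refine ⟨([i], L) :: (P.map (fun q => (q.1, i :: q.2)) ++ P.map (fun q => (i :: q.1, q.2))),
      ?_, ?_⟩
    · intro q hq
      simp only [List.mem_cons, List.mem_append, List.mem_map] at hq
      rcases hq with rfl | ⟨p, hp, rfl⟩ | ⟨p, hp, rfl⟩
      · simp; ring
      · have := hP p hp
        simp; omega
      · have := hP p hp
        simp; omega
    · intro f g hf hg
      have hD : ∀ q : List (Fin d) × List (Fin d),
          Differentiable ℝ (fun x => dL q.1 f x * dL q.2 g x) := fun q =>
        ((hf.dL _).mul (hg.dL _)).differentiable_of_top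
      have h2 := pd_list_sum P hD i
      simp only [dL, h f g hf hg]
      rw [pd_add (hf.mul (hg.dL L)).differentiable_of_top h2.1, h2.2,
        pd_mul hf.differentiable_of_top (hg.dL L).differentiable_of_top]
      funext x
      have h3 : ∀ q : List (Fin d) × List (Fin d), pd i (fun x => dL q.1 f x * dL q.2 g x) x =
          dL q.1 f x * dL (i :: q.2) g x + dL (i :: q.1) f x * dL q.2 g x := fun q => by
        rw [pd_mul (hf.dL _).differentiable_of_top (hg.dL _).differentiable_of_top]
        rfl
      simp only [h3, List.sum_map_add, List.map_cons, List.map_append, List.sum_cons,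
        List.sum_append, List.map_map, Function.comp_def, dL]
      ring

lemma dL_comp_smul (hf : ContDiff ℝ (⊤ : ℕ∞) f) (c : ℝ) (L : List (Fin d)) :
    dL L (fun x => f (c • x)) = fun x => c ^ L.length * dL L f (c • x) := by
  induction L with
  | nil => simp [dL]
  | cons i L ih =>
    have hd : Differentiable ℝ (fun x => dL L f (c • x)) :=
      (hf.dL L).differentiable_of_top.comp (differentiable_id.const_smul c)
    simp only [dL, ih, pd_const_mul hd]
    funext x
    have : pd i (fun x => dL L f (c • x)) x = c * pd i (dL L f) (c • x) := by
      simp only [pd]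
      rw [fderiv_comp_smul]
      simp
    rw [this]
    simp; ring

lemma dL_const_mul (hf : ContDiff ℝ (⊤ : ℕ∞) f) (c : ℝ) (L : List (Fin d)) :
    dL L (fun x => c * f x) = fun x => c * dL L f x := by
  induction L with
  | nil => rfl
  | cons i L ih => simp only [dL, ih, pd_const_mul (hf.dL L).differentiable_of_top]

lemma dL_eq_iteratedFDeriv (hf : ContDiff ℝ (⊤ : ℕ∞) f) (L : List (Fin d))
    (x : EuclideanSpace ℝ (Fin d)) :
    dL L f x = iteratedFDeriv ℝ L.length f x (fun k => EuclideanSpace.single (L.get k) 1) := by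
  induction L generalizing x with
  | nil => simp [dL]
  | cons i L ih =>
    have h1 : dL L f = fun x => iteratedFDeriv ℝ L.length f x
      (fun k => EuclideanSpace.single (L.get k) 1) := funext ih
    have hD : Differentiable ℝ (iteratedFDeriv ℝ L.length f) :=
      hf.differentiable_iteratedFDeriv (by exact_mod_cast WithTop.coe_lt_top _)
    have h2 := fderiv_continuousMultilinear_apply_const_apply (hD x)
      (fun k => EuclideanSpace.single (L.get k) (1 : ℝ)) (EuclideanSpace.single i (1 : ℝ))
    simp only [dL, pd, h1]
    rw [h2]
    exact (iteratedFDeriv_succ_apply_left (n := L.length)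
      (fun k => EuclideanSpace.single ((i :: L).get k) (1 : ℝ))).symm

lemma abs_dL_le_norm_iteratedFDeriv (hf : ContDiff ℝ (⊤ : ℕ∞) f) (L : List (Fin d))
    (x : EuclideanSpace ℝ (Fin d)) :
    |dL L f x| ≤ ‖iteratedFDeriv ℝ L.length f x‖ := by
  rw [dL_eq_iteratedFDeriv hf, ← Real.norm_eq_abs]
  refine (ContinuousMultilinearMap.le_opNorm _ _).trans ?_
  simp

lemma integral_mul_pd (hf : ContDiff ℝ (⊤ : ℕ∞) f) (hg : ContDiff ℝ (⊤ : ℕ∞) g)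
    (hc : HasCompactSupport g) (i : Fin d) :
    ∫ x, f x * pd i g x = -∫ x, pd i f x * g x := by
  refine integral_mul_fderiv_eq_neg_fderiv_mul_of_integrable ?_ ?_ ?_
    (fun x _ => hf.differentiable_of_top x) (fun x _ => hg.differentiable_of_top x)
  · exact ((hf.pd i).continuous.mul hg.continuous).integrable_of_hasCompactSupport hc.mul_left
  · exact (hf.continuous.mul (hg.pd i).continuous).integrable_of_hasCompactSupport
      (hc.pd i).mul_left
  · exact (hf.continuous.mul hg.continuous).integrable_of_hasCompactSupport hc.mul_left

lemma integral_mul_lap (hf : ContDiff ℝ (⊤ : ℕ∞) f) (hg : ContDiff ℝ (⊤ : ℕ∞) g)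
    (hc : HasCompactSupport g) :
    ∫ x, f x * lap g x = ∑ i, ∫ x, pd i f x * pd i g x := by
  have h : ∀ x, f x * lap g x = -∑ i, f x * pd i (pd i g) x := fun x => by
    simp [lap, Finset.mul_sum]
  simp only [h, integral_neg]
  rw [integral_finsetSum (f := fun i x => f x * pd i (pd i g) x) _ fun i _ =>
    (hf.continuous.mul ((hg.pd i).pd i).continuous).integrable_of_hasCompactSupport
      ((hc.pd i).pd i).mul_left, ← Finset.sum_neg_distrib]
  exact Finset.sum_congr rfl fun i _ => by
    rw [integral_mul_pd hf (hg.pd i) (hc.pd i), neg_neg]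

lemma integral_mul_lap_comm (hf : ContDiff ℝ (⊤ : ℕ∞) f) (hg : ContDiff ℝ (⊤ : ℕ∞) g)
    (hc : HasCompactSupport g) :
    ∫ x, f x * lap g x = ∫ x, lap f x * g x := by
  rw [integral_mul_lap hf hg hc]
  have h : ∀ x, lap f x * g x = -∑ i, pd i (pd i f) x * g x := fun x => by
    simp [lap, Finset.sum_mul]
  simp only [h, integral_neg]
  rw [integral_finsetSum (f := fun i x => pd i (pd i f) x * g x) _ fun i _ =>
    (((hf.pd i).pd i).continuous.mul hg.continuous).integrable_of_hasCompactSupport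
      hc.mul_left, ← Finset.sum_neg_distrib]
  exact Finset.sum_congr rfl fun i _ => by
    rw [integral_mul_pd (hf.pd i) hg hc]

lemma integral_iterate_lap_mul (k : ℕ) (hf : ContDiff ℝ (⊤ : ℕ∞) f)
    (hc : HasCompactSupport f) (hg : ContDiff ℝ (⊤ : ℕ∞) g) :
    ∫ x, lap^[k] f x * g x = ∑ I : Fin k → Fin d,
      ∫ x, dL (List.ofFn I) f x * dL (List.ofFn I) g x := by
  induction k generalizing f with
  | zero => simp [dL]
  | succ k ih =>
    rw [Function.iterate_succ_apply, ih hf.lap hc.lap,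
      ← (Fin.consEquiv (fun _ => Fin d)).sum_comp, Fintype.sum_prod_type_right]
    refine Finset.sum_congr rfl fun I _ => ?_
    have hI : ∀ i, List.ofFn ((Fin.consEquiv fun _ => Fin d) (i, I)) = i :: List.ofFn I :=
      fun i => List.ofFn_cons i I
    simp only [← lap_dL hf, hI, dL]
    have := integral_mul_lap (hg.dL (List.ofFn I)) (hf.dL (List.ofFn I)) (hc.dL _)
    simpa only [mul_comm] using this

end Calculus

section Sobolev

variable {d : ℕ}

lemma norm_fderiv_le_sum_pd (f : EuclideanSpace ℝ (Fin d) → ℝ) (x : EuclideanSpace ℝ (Fin d)) :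
    ‖fderiv ℝ f x‖ ≤ ∑ i, |pd i f x| := by
  refine ContinuousLinearMap.opNorm_le_bound _ (Finset.sum_nonneg fun _ _ => abs_nonneg _)
    fun v => ?_
  have hv : v = ∑ i, v i • EuclideanSpace.single i (1 : ℝ) := by
    ext j
    simp [Finset.sum_apply, Pi.single_apply]
  have h : fderiv ℝ f x v = ∑ i, v i * pd i f x := by
    conv_lhs => rw [hv]
    simp [map_sum, pd]
  rw [h, Finset.sum_mul]
  refine (norm_sum_le _ _).trans (Finset.sum_le_sum fun i _ => ?_)
  rw [norm_mul, mul_comm]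
  exact mul_le_mul_of_nonneg_left (PiLp.norm_apply_le v i) (abs_nonneg _)

/-- Iterated Gagliardo–Nirenberg–Sobolev inequality, with exponents given by their inverses. -/
lemma exists_sobolev (hd : 0 < d) (n : ℕ) (e : NNReal) (he : 0 < e)
    (h1 : e + n / d ≤ 1) : ∃ C : NNReal, ∀ f : EuclideanSpace ℝ (Fin d) → ℝ,
      ContDiff ℝ (⊤ : ℕ∞) f → HasCompactSupport f → ∀ M : ENNReal,
      (∀ L : List (Fin d), L.length = n →
        eLpNorm (dL L f) ((e + n / d : NNReal) : ENNReal)⁻¹ volume ≤ M) →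
      eLpNorm f (e : ENNReal)⁻¹ volume ≤ C * M := by
  induction n generalizing e with
  | zero => exact ⟨1, fun f _ _ M hM => by simpa [dL] using hM [] rfl⟩
  | succ n ih =>
    have hd' : (0 : NNReal) < d := by exact_mod_cast hd
    have hee : e + ((n + 1 : ℕ) : NNReal) / d = (e + 1 / d) + n / d := by
      push_cast; rw [add_div]; ring
    rw [hee] at h1 ⊢
    obtain ⟨C, hC⟩ := ih (e + 1 / d) (by positivity) h1
    have he1 : e + 1 / d ≤ 1 := le_trans (by simp) h1
    have hp : 1 ≤ (e + 1 / d)⁻¹ := (one_le_inv₀ (by positivity)).2 he1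
    refine ⟨SNormLESNormFDerivOfEqConst ℝ (volume : Measure (EuclideanSpace ℝ (Fin d)))
      (((e + 1 / d)⁻¹ : NNReal) : ℝ) * (d * C), fun f hf hc M hM => ?_⟩
    have hS := eLpNorm_le_eLpNorm_fderiv_of_eq (volume : Measure (EuclideanSpace ℝ (Fin d)))
      (hf.of_le (by simp)) hc (p := (e + 1 / d)⁻¹) (p' := e⁻¹) hp (by simpa using hd)
      (by simp)
    rw [ENNReal.coe_inv he.ne', ENNReal.coe_inv (by positivity : e + 1 / d ≠ 0)] at hS
    refine hS.trans ?_
    rw [ENNReal.coe_mul, mul_assoc]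
    refine mul_le_mul_right ?_ _
    calc eLpNorm (fderiv ℝ f) ((e + 1 / d : NNReal) : ENNReal)⁻¹ volume
        ≤ eLpNorm (∑ i, fun x => |pd i f x|) ((e + 1 / d : NNReal) : ENNReal)⁻¹ volume :=
          eLpNorm_mono_real fun x => by
            simpa using norm_fderiv_le_sum_pd f x
      _ ≤ ∑ i, eLpNorm (fun x => |pd i f x|) ((e + 1 / d : NNReal) : ENNReal)⁻¹ volume := by
          refine eLpNorm_sum_le (fun i _ => (hf.pd i).continuous.abs.aestronglyMeasurable) ?_
          rw [ENNReal.one_le_inv]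
          exact_mod_cast he1
      _ ≤ ∑ i : Fin d, C * M := by
          refine Finset.sum_le_sum fun i _ => ?_
          have : eLpNorm (fun x => |pd i f x|) ((e + 1 / d : NNReal) : ENNReal)⁻¹ volume
              = eLpNorm (pd i f) ((e + 1 / d : NNReal) : ENNReal)⁻¹ volume := eLpNorm_norm (pd i f)
          rw [this]
          refine hC _ (hf.pd i) (hc.pd i) M fun L hL => ?_
          have h3 := hM (L ++ [i]) (by simp [hL])
          rwa [dL_append] at h3
      _ = ↑(d * C) * M := by simp [mul_assoc]

lemma abs_integral_mul_mul_le {f g h : EuclideanSpace ℝ (Fin d) → ℝ} (hf : Continuous f)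
    (hg : Continuous g) (hh : Continuous h) {e₁ e₂ : NNReal} (he : e₁ + e₂ = 1 / 2)
    {F G H : ℝ} (hF : 0 ≤ F) (hG : 0 ≤ G) (hH : 0 ≤ H)
    (hf' : eLpNorm f 2 volume ≤ ENNReal.ofReal F)
    (hg' : eLpNorm g (e₁ : ENNReal)⁻¹ volume ≤ ENNReal.ofReal G)
    (hh' : eLpNorm h (e₂ : ENNReal)⁻¹ volume ≤ ENNReal.ofReal H) :
    |∫ x, f x * (g x * h x)| ≤ F * (G * H) := by
  have : ENNReal.HolderTriple (e₁ : ENNReal)⁻¹ (e₂ : ENNReal)⁻¹ 2 := ⟨by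
    rw [inv_inv, inv_inv, ← ENNReal.coe_add, he]
    simp⟩
  have h1 : eLpNorm (g • h) 2 volume ≤ ENNReal.ofReal G * ENNReal.ofReal H :=
    (eLpNorm_smul_le_mul_eLpNorm hh.aestronglyMeasurable hg.aestronglyMeasurable).trans
      (mul_le_mul' hg' hh')
  have h2 : eLpNorm (f • (g • h)) 1 volume ≤
      ENNReal.ofReal F * (ENNReal.ofReal G * ENNReal.ofReal H) :=
    (eLpNorm_smul_le_mul_eLpNorm (hg.mul hh).aestronglyMeasurable
      hf.aestronglyMeasurable (p := 2) (q := 2)).trans (mul_le_mul' hf' h1)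
  rw [← ENNReal.ofReal_mul hG, ← ENNReal.ofReal_mul hF, eLpNorm_one_eq_lintegral_enorm] at h2
  have h3 : ‖∫ x, f x * (g x * h x)‖ₑ ≤ ENNReal.ofReal (F * (G * H)) :=
    (enorm_integral_le_lintegral_enorm _).trans h2
  rw [← ofReal_norm, Real.norm_eq_abs] at h3
  exact (ENNReal.ofReal_le_ofReal_iff (by positivity)).1 h3

end Sobolev

section Energy

variable {d : ℕ} {f : EuclideanSpace ℝ (Fin d) → ℝ}

lemma integral_sq_dL_le (hf : ContDiff ℝ (⊤ : ℕ∞) f) (hc : HasCompactSupport f)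
    (L : List (Fin d)) :
    ∫ x, dL L f x * dL L f x ≤ ∫ x, lap^[L.length] f x * f x := by
  rw [integral_iterate_lap_mul _ hf hc hf]
  have := Finset.single_le_sum (f := fun I : Fin L.length → Fin d =>
    ∫ x, dL (List.ofFn I) f x * dL (List.ofFn I) f x)
    (fun I _ => integral_nonneg fun x => mul_self_nonneg _) (Finset.mem_univ L.get)
  simpa only [List.ofFn_get] using this

lemma integral_iterate_lap_mul_self_nonneg (hf : ContDiff ℝ (⊤ : ℕ∞) f)
    (hc : HasCompactSupport f) (m : ℕ) : 0 ≤ ∫ x, lap^[m] f x * f x := by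
  rw [integral_iterate_lap_mul _ hf hc hf]
  exact Finset.sum_nonneg fun I _ => integral_nonneg fun x => mul_self_nonneg _

lemma eLpNorm_dL_le (hf : ContDiff ℝ (⊤ : ℕ∞) f) (hc : HasCompactSupport f)
    (L : List (Fin d)) :
    eLpNorm (dL L f) 2 volume ≤ ENNReal.ofReal √(∫ x, lap^[L.length] f x * f x) := by
  have hm : MemLp (dL L f) 2 volume :=
    (hf.dL L).continuous.memLp_of_hasCompactSupport (hc.dL L)
  rw [hm.eLpNorm_eq_integral_rpow_norm (by simp) (by simp), Real.sqrt_eq_rpow]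
  refine ENNReal.ofReal_le_ofReal ?_
  simp only [ENNReal.toReal_ofNat, Real.rpow_ofNat, one_div, Real.norm_eq_abs, sq_abs]
  refine Real.rpow_le_rpow (integral_nonneg fun x => sq_nonneg _) ?_ (by norm_num)
  simpa only [sq] using integral_sq_dL_le hf hc L

end Energy

section Field

variable {d : ℕ} {u : EuclideanSpace ℝ (Fin d) → EuclideanSpace ℝ (Fin d)}

lemma contDiff_component (hu : ContDiff ℝ (⊤ : ℕ∞) u) (j : Fin d) :
    ContDiff ℝ (⊤ : ℕ∞) (fun x => u x j) :=
  (EuclideanSpace.proj (𝕜 := ℝ) j).contDiff.comp hu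

lemma hasCompactSupport_component (hc : HasCompactSupport u) (j : Fin d) :
    HasCompactSupport (fun x => u x j) :=
  hc.comp_left (g := fun v : EuclideanSpace ℝ (Fin d) => v j) rfl

lemma norm_proj_le_one (j : Fin d) : ‖EuclideanSpace.proj (𝕜 := ℝ) j‖ ≤ 1 :=
  ContinuousLinearMap.opNorm_le_bound _ zero_le_one fun v => by
    simpa using PiLp.norm_apply_le v j

lemma bddAbove_norm_fderiv (hu : ContDiff ℝ (⊤ : ℕ∞) u) (hc : HasCompactSupport u) :
    BddAbove (Set.range fun x => ‖fderiv ℝ u x‖) :=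
  (hu.continuous_fderiv (by simp)).norm.bddAbove_range_of_hasCompactSupport (hc.fderiv ℝ).norm

lemma abs_pd_component_le (hu : ContDiff ℝ (⊤ : ℕ∞) u) (hc : HasCompactSupport u)
    (i j : Fin d) (x : EuclideanSpace ℝ (Fin d)) :
    |pd i (fun x => u x j) x| ≤ ⨆ x, ‖fderiv ℝ u x‖ := by
  refine le_trans ?_ (le_ciSup (bddAbove_norm_fderiv hu hc) x)
  have h : pd i (fun x => u x j) x = fderiv ℝ u x (EuclideanSpace.single i 1) j := by
    have := ((EuclideanSpace.proj (𝕜 := ℝ) j).hasFDerivAt.comp x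
      (hu.differentiable (by simp) x).hasFDerivAt).fderiv
    change fderiv ℝ (EuclideanSpace.proj (𝕜 := ℝ) j ∘ u) x (EuclideanSpace.single i 1) = _
    rw [this]
    rfl
  rw [h, ← Real.norm_eq_abs]
  refine (PiLp.norm_apply_le _ j).trans ?_
  simpa using (fderiv ℝ u x).le_opNorm (EuclideanSpace.single i 1)

lemma sobSeminorm_nonneg (k : ℕ) (p : ℝ) : 0 ≤ sobSeminorm d k p u :=
  Real.rpow_nonneg (integral_nonneg fun _ => Real.rpow_nonneg (norm_nonneg _) _) _

lemma eLpNorm_dL_component_le (hu : ContDiff ℝ (⊤ : ℕ∞) u) (hc : HasCompactSupport u)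
    (L : List (Fin d)) (j : Fin d) {e : NNReal} (he : 0 < e) {p : ℝ} (hp : p = (e : ℝ)⁻¹) :
    eLpNorm (dL L fun x => u x j) (e : ENNReal)⁻¹ volume ≤
      ENNReal.ofReal (sobSeminorm d L.length p u) := by
  have hcont : Continuous (iteratedFDeriv ℝ L.length u) :=
    hu.continuous_iteratedFDeriv (by exact_mod_cast le_top)
  have hm : MemLp (iteratedFDeriv ℝ L.length u) (e : ENNReal)⁻¹ volume :=
    hcont.memLp_of_hasCompactSupport (hc.iteratedFDeriv _)
  have h := hm.eLpNorm_eq_integral_rpow_norm (by simp) (by simpa using he.ne')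
  have hpe : ((e : ENNReal)⁻¹).toReal = p := by simp [hp]
  rw [hpe] at h
  refine le_trans (eLpNorm_mono fun x => ?_) h.le
  refine (abs_dL_le_norm_iteratedFDeriv (contDiff_component hu j) L x).trans ?_
  refine ((EuclideanSpace.proj (𝕜 := ℝ) j).norm_iteratedFDeriv_comp_left
    (hu.contDiffAt (x := x)) (by exact_mod_cast le_top)).trans ?_
  exact mul_le_of_le_one_left (norm_nonneg _) (norm_proj_le_one j)

/-- Norms of intermediate derivatives of a vector field are controlled by the first and the
last one. -/
lemma exists_eLpNorm_dL_component_le {m k : ℕ} (hm : 2 ≤ m) (hmd : m < d) (hk : 1 ≤ k)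
    (hkm : k ≤ m) : ∃ C : ℝ, 0 ≤ C ∧
      ∀ u : EuclideanSpace ℝ (Fin d) → EuclideanSpace ℝ (Fin d),
      ContDiff ℝ (⊤ : ℕ∞) u → HasCompactSupport u →
      ∀ A : List (Fin d), A.length = k → ∀ j : Fin d,
        eLpNorm (dL A fun x => u x j) (((k - 1 : ℕ) : NNReal) / d : NNReal)⁻¹ volume ≤
        ENNReal.ofReal (C * ((⨆ x, ‖fderiv ℝ u x‖)
          + sobSeminorm d m ((d : ℝ) / ((m : ℝ) - 1)) u)) := by
  have hd : 0 < d := by omega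
  have hd' : (0 : NNReal) < d := by exact_mod_cast hd
  rcases hk.eq_or_lt with rfl | hk
  · refine ⟨1, zero_le_one, fun u hu hc A hA j => ?_⟩
    obtain ⟨i, rfl⟩ := List.length_eq_one_iff.1 hA
    simp only [le_refl, tsub_eq_zero_of_le, Nat.cast_zero, zero_div, ENNReal.coe_zero,
      ENNReal.inv_zero, eLpNorm_exponent_top]
    refine eLpNormEssSup_le_of_ae_bound (Filter.Eventually.of_forall fun x => ?_)
    rw [one_mul]
    exact (abs_pd_component_le hu hc i j x).trans
      (le_add_of_nonneg_right (sobSeminorm_nonneg _ _))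
  · have he : (0 : NNReal) < ((k - 1 : ℕ) : NNReal) / d :=
      div_pos (by exact_mod_cast (by omega : 0 < k - 1)) hd'
    have hsum : ((k - 1 : ℕ) : NNReal) / d + ((m - k : ℕ) : NNReal) / d
        = ((m - 1 : ℕ) : NNReal) / d := by
      rw [← add_div, ← Nat.cast_add]
      congr 3
      omega
    obtain ⟨C, hC⟩ := exists_sobolev hd (m - k) _ he (by
      rw [hsum, div_le_one hd']
      exact_mod_cast (by omega : m - 1 ≤ d))
    refine ⟨C, C.coe_nonneg, fun u hu hc A hA j => ?_⟩
    have h := hC _ ((contDiff_component hu j).dL A) ((hasCompactSupport_component hc j).dL A)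
      (ENNReal.ofReal (sobSeminorm d m ((d : ℝ) / ((m : ℝ) - 1)) u)) (fun L hL => by
        rw [hsum, ← dL_append]
        have hl : (L ++ A).length = m := by simp [hL, hA]; omega
        have h1 := eLpNorm_dL_component_le hu hc (L ++ A) j
          (e := ((m - 1 : ℕ) : NNReal) / d) (p := (d : ℝ) / ((m : ℝ) - 1))
          (div_pos (by exact_mod_cast (by omega : 0 < m - 1)) hd')
          (by
            simp only [NNReal.coe_div, NNReal.coe_natCast, Nat.cast_sub (by omega : 1 ≤ m),
              Nat.cast_one, inv_div])
        rwa [hl] at h1)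
    refine h.trans ?_
    rw [ENNReal.ofReal_mul C.coe_nonneg, ENNReal.ofReal_coe_nnreal]
    refine mul_le_mul_right (ENNReal.ofReal_le_ofReal ?_) _
    exact le_add_of_nonneg_left (Real.iSup_nonneg fun x => norm_nonneg _)

end Field

section Commutator

variable {d : ℕ}

/-- The commutator terms in the energy estimate. -/
lemma exists_abs_integral_commutator_le {m : ℕ} (hm : 2 ≤ m) (hmd : 2 * m < d)
    (I A B : List (Fin d)) (hI : I.length = m) (hA : 1 ≤ A.length)
    (hAB : A.length + B.length = m) (j : Fin d) : ∃ C : ℝ, 0 ≤ C ∧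
      ∀ u : EuclideanSpace ℝ (Fin d) → EuclideanSpace ℝ (Fin d),
      ContDiff ℝ (⊤ : ℕ∞) u → HasCompactSupport u →
      ∀ f : EuclideanSpace ℝ (Fin d) → ℝ, ContDiff ℝ (⊤ : ℕ∞) f → HasCompactSupport f →
        |∫ x, dL I f x * (dL A (fun x => u x j) x * dL B (pd j f) x)| ≤
          C * ((⨆ x, ‖fderiv ℝ u x‖) + sobSeminorm d m ((d : ℝ) / ((m : ℝ) - 1)) u) *
            ∫ x, lap^[m] f x * f x := by
  have hd : 0 < d := by omega
  have hd' : (0 : NNReal) < d := by exact_mod_cast hd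
  set k := A.length with hk
  obtain ⟨C, hC0, hC⟩ := exists_eLpNorm_dL_component_le (d := d) hm (by omega) hA
    (by omega : k ≤ m)
  have hlt : ((k - 1 : ℕ) : NNReal) / d < 1 / 2 := by
    rw [div_lt_iff₀ hd', one_div, inv_mul_eq_div, lt_div_iff₀ two_pos]
    exact_mod_cast (by omega : (k - 1) * 2 < d)
  have he : (0 : NNReal) < 1 / 2 - ((k - 1 : ℕ) : NNReal) / d := tsub_pos_of_lt hlt
  have hsum : 1 / 2 - ((k - 1 : ℕ) : NNReal) / d + ((k - 1 : ℕ) : NNReal) / d = 1 / 2 :=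
    tsub_add_cancel_of_le hlt.le
  obtain ⟨D, hD⟩ := exists_sobolev hd (k - 1) _ he (by
    rw [hsum]; exact half_le_self zero_le_one)
  refine ⟨C * D, mul_nonneg hC0 D.coe_nonneg, fun u hu huc f hf hfc => ?_⟩
  set N := (⨆ x, ‖fderiv ℝ u x‖) + sobSeminorm d m ((d : ℝ) / ((m : ℝ) - 1)) u with hN
  have hN0 : 0 ≤ N := add_nonneg (Real.iSup_nonneg fun x => norm_nonneg _)
    (sobSeminorm_nonneg _ _)
  have hQ := integral_iterate_lap_mul_self_nonneg hf hfc m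
  set Q := ∫ x, lap^[m] f x * f x with hQdef
  have h1 : eLpNorm (dL I f) 2 volume ≤ ENNReal.ofReal √Q := by
    have := eLpNorm_dL_le hf hfc I
    rwa [hI] at this
  have h2 := hC u hu huc A rfl j
  have h3 := hD _ ((hf.pd j).dL B) ((hfc.pd j).dL B) (ENNReal.ofReal √Q) (fun L hL => by
    rw [hsum, dL_pd hf]
    have hl : (L ++ j :: B).length = m := by simp [hL]; omega
    have := eLpNorm_dL_le hf hfc (L ++ j :: B)
    rw [hl, dL_append] at this
    simpa [dL] using this)
  rw [← ENNReal.ofReal_coe_nnreal (p := D), ← ENNReal.ofReal_mul D.coe_nonneg] at h3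
  have h4 := abs_integral_mul_mul_le (hf.dL I).continuous
    ((contDiff_component hu j).dL A).continuous ((hf.pd j).dL B).continuous
    (by rw [add_comm]; exact hsum) (Real.sqrt_nonneg Q) (mul_nonneg hC0 hN0)
    (mul_nonneg D.coe_nonneg (Real.sqrt_nonneg Q)) h1 h2 h3
  refine h4.trans (le_of_eq ?_)
  have := Real.mul_self_sqrt hQ
  linear_combination C * N * D * this

lemma abs_integral_transport_le {u : EuclideanSpace ℝ (Fin d) → EuclideanSpace ℝ (Fin d)}
    (hu : ContDiff ℝ (⊤ : ℕ∞) u) (huc : HasCompactSupport u)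
    {f : EuclideanSpace ℝ (Fin d) → ℝ} (hf : ContDiff ℝ (⊤ : ℕ∞) f)
    (hfc : HasCompactSupport f) (j : Fin d) :
    |∫ x, f x * (u x j * pd j f x)| ≤ (⨆ x, ‖fderiv ℝ u x‖) * ∫ x, f x * f x := by
  have hw := contDiff_component hu j
  have hwc := hasCompactSupport_component huc j
  have hfd := hf.differentiable_of_top
  have key := integral_mul_pd (hw) (hf.mul hf) (hfc.mul_right) j
  have h1 : ∀ x, u x j * pd j (fun x => f x * f x) x = 2 * (f x * (u x j * pd j f x)) :=
    fun x => by rw [pd_mul hfd hfd]; ring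
  have key' : 2 * ∫ x, f x * (u x j * pd j f x) =
      -∫ x, pd j (fun x => u x j) x * (f x * f x) := by
    rw [← integral_const_mul, ← key]
    exact integral_congr_ae (Filter.Eventually.of_forall fun x => (h1 x).symm)
  have hint : Integrable (fun x => f x * f x) volume :=
    (hf.mul hf).continuous.integrable_of_hasCompactSupport hfc.mul_right
  have hb : |∫ x, pd j (fun x => u x j) x * (f x * f x)| ≤
      (⨆ x, ‖fderiv ℝ u x‖) * ∫ x, f x * f x := by
    rw [← integral_const_mul, ← Real.norm_eq_abs]
    refine norm_integral_le_of_norm_le (hint.const_mul _)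
      (Filter.Eventually.of_forall fun x => ?_)
    rw [norm_mul, Real.norm_of_nonneg (mul_self_nonneg (f x))]
    exact mul_le_mul_of_nonneg_right (abs_pd_component_le hu huc j j x) (mul_self_nonneg _)
  have h0 : |∫ x, f x * (u x j * pd j f x)| * 2 = |∫ x, pd j (fun x => u x j) x * (f x * f x)| := by
    rw [← abs_neg (∫ x, pd j (fun x => u x j) x * (f x * f x)), ← key', abs_mul]
    norm_num [mul_comm]
  linarith [abs_nonneg (∫ x, f x * (u x j * pd j f x))]

lemma exists_abs_integral_dL_mul_le {m : ℕ} (hm : 2 ≤ m) (hmd : 2 * m < d)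
    (I : List (Fin d)) (hI : I.length = m) (j : Fin d) : ∃ C : ℝ, 0 ≤ C ∧
      ∀ u : EuclideanSpace ℝ (Fin d) → EuclideanSpace ℝ (Fin d),
      ContDiff ℝ (⊤ : ℕ∞) u → HasCompactSupport u →
      ∀ f : EuclideanSpace ℝ (Fin d) → ℝ, ContDiff ℝ (⊤ : ℕ∞) f → HasCompactSupport f →
        |∫ x, dL I f x * dL I (fun x => u x j * pd j f x) x| ≤
          C * ((⨆ x, ‖fderiv ℝ u x‖) + sobSeminorm d m ((d : ℝ) / ((m : ℝ) - 1)) u) *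
            ∫ x, lap^[m] f x * f x := by
  obtain ⟨P, hP, hL⟩ := exists_leibniz I
  have hlist : ∀ P : List (List (Fin d) × List (Fin d)),
      (∀ q ∈ P, 1 ≤ q.1.length ∧ q.1.length + q.2.length = I.length) → ∃ C : ℝ, 0 ≤ C ∧
      ∀ u : EuclideanSpace ℝ (Fin d) → EuclideanSpace ℝ (Fin d),
      ContDiff ℝ (⊤ : ℕ∞) u → HasCompactSupport u →
      ∀ f : EuclideanSpace ℝ (Fin d) → ℝ, ContDiff ℝ (⊤ : ℕ∞) f → HasCompactSupport f →
        Integrable (fun x => dL I f x *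
          (P.map fun q => dL q.1 (fun x => u x j) x * dL q.2 (pd j f) x).sum) volume ∧
        |∫ x, dL I f x * (P.map fun q => dL q.1 (fun x => u x j) x * dL q.2 (pd j f) x).sum| ≤
          C * ((⨆ x, ‖fderiv ℝ u x‖) + sobSeminorm d m ((d : ℝ) / ((m : ℝ) - 1)) u) *
            ∫ x, lap^[m] f x * f x := by
    intro P
    induction P with
    | nil => exact fun _ => ⟨0, le_rfl, fun u _ _ f _ _ => by simp⟩
    | cons q P ih =>
      intro hq
      obtain ⟨C₁, hC₁, h₁⟩ := ih fun r hr => hq r (List.mem_cons_of_mem _ hr)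
      obtain ⟨hq1, hq2⟩ := hq q List.mem_cons_self
      obtain ⟨C₂, hC₂, h₂⟩ := exists_abs_integral_commutator_le hm hmd I q.1 q.2 hI hq1
        (hq2.trans hI) j
      refine ⟨C₂ + C₁, add_nonneg hC₂ hC₁, fun u hu huc f hf hfc => ?_⟩
      obtain ⟨hi, hb⟩ := h₁ u hu huc f hf hfc
      have hi' : Integrable (fun x => dL I f x *
          (dL q.1 (fun x => u x j) x * dL q.2 (pd j f) x)) volume :=
        ((hf.dL I).continuous.mul (((contDiff_component hu j).dL q.1).continuous.mul
          ((hf.pd j).dL q.2).continuous)).integrable_of_hasCompactSupport (hfc.dL I).mul_right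
      simp only [List.map_cons, List.sum_cons, mul_add]
      refine ⟨hi'.add hi, ?_⟩
      rw [integral_add hi' hi]
      refine (abs_add_le _ _).trans ((add_le_add (h₂ u hu huc f hf hfc) hb).trans (le_of_eq ?_))
      ring
  obtain ⟨C, hC, h⟩ := hlist P hP
  refine ⟨1 + C, by positivity, fun u hu huc f hf hfc => ?_⟩
  obtain ⟨hi, hb⟩ := h u hu huc f hf hfc
  have hi' : Integrable (fun x => dL I f x * (u x j * pd j (dL I f) x)) volume :=
    ((hf.dL I).continuous.mul ((contDiff_component hu j).continuous.mul
      ((hf.dL I).pd j).continuous)).integrable_of_hasCompactSupport (hfc.dL I).mul_right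
  rw [hL _ _ (contDiff_component hu j) (hf.pd j)]
  simp only [mul_add, dL_pd hf] at hi hb ⊢
  rw [integral_add hi' hi]
  have h1 := abs_integral_transport_le hu huc (hf.dL I) (hfc.dL I) j
  have h2 := integral_sq_dL_le hf hfc I
  rw [hI] at h2
  have hA : 0 ≤ ⨆ x, ‖fderiv ℝ u x‖ := Real.iSup_nonneg fun x => norm_nonneg _
  have hQ := integral_iterate_lap_mul_self_nonneg hf hfc m
  have h3 : (⨆ x, ‖fderiv ℝ u x‖) * ∫ x, dL I f x * dL I f x ≤
      ((⨆ x, ‖fderiv ℝ u x‖) + sobSeminorm d m ((d : ℝ) / ((m : ℝ) - 1)) u) *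
        ∫ x, lap^[m] f x * f x :=
    (mul_le_mul_of_nonneg_left h2 hA).trans (mul_le_mul_of_nonneg_right
      (le_add_of_nonneg_right (sobSeminorm_nonneg _ _)) hQ)
  refine (abs_add_le _ _).trans ((add_le_add (h1.trans h3) hb).trans (le_of_eq ?_))
  ring

/-- The energy estimate for compactly supported potentials. -/
theorem exists_abs_integral_iterate_lap_mul_transport_le {m : ℕ} (hm : 2 ≤ m)
    (hmd : 2 * m < d) : ∃ C : ℝ, 0 ≤ C ∧
      ∀ u : EuclideanSpace ℝ (Fin d) → EuclideanSpace ℝ (Fin d),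
      ContDiff ℝ (⊤ : ℕ∞) u → HasCompactSupport u →
      ∀ f : EuclideanSpace ℝ (Fin d) → ℝ, ContDiff ℝ (⊤ : ℕ∞) f → HasCompactSupport f →
        |∫ x, lap^[m] f x * ∑ j, u x j * pd j f x| ≤
          C * ((⨆ x, ‖fderiv ℝ u x‖) + sobSeminorm d m ((d : ℝ) / ((m : ℝ) - 1)) u) *
            ∫ x, lap^[m] f x * f x := by
  choose C hC0 hC using fun (I : Fin m → Fin d) (j : Fin d) =>
    exists_abs_integral_dL_mul_le hm hmd (List.ofFn I) (by simp) j
  refine ⟨∑ j, ∑ I, C I j, Finset.sum_nonneg fun j _ => Finset.sum_nonneg fun I _ => hC0 I j,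
    fun u hu huc f hf hfc => ?_⟩
  have hg : ∀ j, ContDiff ℝ (⊤ : ℕ∞) (fun x => u x j * pd j f x) := fun j =>
    (contDiff_component hu j).mul (hf.pd j)
  simp only [Finset.mul_sum]
  rw [integral_finsetSum (f := fun j x => lap^[m] f x * (u x j * pd j f x)) _ fun j _ =>
    ((hf.iterate_lap m).mul (hg j)).continuous.integrable_of_hasCompactSupport
      (hfc.iterate_lap m).mul_right]
  rw [Finset.sum_mul, Finset.sum_mul]
  refine (Finset.abs_sum_le_sum_abs _ _).trans (Finset.sum_le_sum fun j _ => ?_)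
  rw [integral_iterate_lap_mul m hf hfc (hg j), Finset.sum_mul, Finset.sum_mul]
  exact (Finset.abs_sum_le_sum_abs _ _).trans
    (Finset.sum_le_sum fun I _ => hC I j u hu huc f hf hfc)

end Commutator

section Convolution

variable {d : ℕ}

/-- The scalar convolution `∫ F(t) g(x - t) dt`. -/
def conv (F g : EuclideanSpace ℝ (Fin d) → ℝ) : EuclideanSpace ℝ (Fin d) → ℝ :=
  fun x => ∫ t, F t * g (x - t)

variable {F g : EuclideanSpace ℝ (Fin d) → ℝ}

lemma ContDiff.conv (hF : LocallyIntegrable F volume) (hg : ContDiff ℝ (⊤ : ℕ∞) g)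
    (hc : HasCompactSupport g) : ContDiff ℝ (⊤ : ℕ∞) (conv F g) :=
  hc.contDiff_convolution_right (ContinuousLinearMap.mul ℝ ℝ) hF hg

lemma pd_conv (hF : LocallyIntegrable F volume) (hg : ContDiff ℝ (⊤ : ℕ∞) g)
    (hc : HasCompactSupport g) (i : Fin d) : pd i (conv F g) = conv F (pd i g) := by
  funext x
  have h := (hc.hasFDerivAt_convolution_right (ContinuousLinearMap.mul ℝ ℝ) hF
    (hg.of_le (by simp)) x).fderiv
  change fderiv ℝ (convolution F g (ContinuousLinearMap.mul ℝ ℝ) volume) x _ = _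
  rw [h, convolution_precompR_apply _ hF (hc.fderiv ℝ) (hg.continuous_fderiv (by simp))]
  rfl

lemma dL_conv (hF : LocallyIntegrable F volume) (hg : ContDiff ℝ (⊤ : ℕ∞) g)
    (hc : HasCompactSupport g) (L : List (Fin d)) : dL L (conv F g) = conv F (dL L g) := by
  induction L with
  | nil => rfl
  | cons i L ih => simp only [dL, ih, pd_conv hF (hg.dL L) (hc.dL L)]

lemma integrable_mul_of_locallyIntegrable (hF : LocallyIntegrable F volume) (hg : Continuous g)
    (hc : HasCompactSupport g) : Integrable (fun t => F t * g t) volume := by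
  simpa [mul_comm] using hF.integrable_smul_left_of_hasCompactSupport hg hc

lemma contDiff_comp_sub (hg : ContDiff ℝ (⊤ : ℕ∞) g) (x : EuclideanSpace ℝ (Fin d)) :
    ContDiff ℝ (⊤ : ℕ∞) (fun t => g (x - t)) :=
  hg.comp (contDiff_const.sub contDiff_id)

lemma hasCompactSupport_comp_sub (hc : HasCompactSupport g) (x : EuclideanSpace ℝ (Fin d)) :
    HasCompactSupport (fun t => g (x - t)) :=
  hc.comp_homeomorph (Homeomorph.subLeft x)

lemma lap_conv (hF : LocallyIntegrable F volume) (hg : ContDiff ℝ (⊤ : ℕ∞) g)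
    (hc : HasCompactSupport g) : lap (conv F g) = conv F (lap g) := by
  funext x
  have h : ∀ i, Integrable (fun t => F t * pd i (pd i g) (x - t)) volume := fun i =>
    integrable_mul_of_locallyIntegrable hF
      (contDiff_comp_sub ((hg.pd i).pd i) x).continuous
      (hasCompactSupport_comp_sub ((hc.pd i).pd i) x)
  have hl : ∀ t, F t * lap g (x - t) = -∑ i, F t * pd i (pd i g) (x - t) := fun t => by
    simp [lap, Finset.mul_sum]
  rw [lap]
  simp only [pd_conv hF hg hc, pd_conv hF (hg.pd _) (hc.pd _)]
  simp only [conv, hl, integral_neg]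
  rw [integral_finsetSum (f := fun i t => F t * pd i (pd i g) (x - t)) _ fun i _ => h i]

lemma iterate_lap_conv (hF : LocallyIntegrable F volume) (hg : ContDiff ℝ (⊤ : ℕ∞) g)
    (hc : HasCompactSupport g) (k : ℕ) : lap^[k] (conv F g) = conv F (lap^[k] g) := by
  induction k generalizing g with
  | zero => rfl
  | succ k ih =>
    rw [Function.iterate_succ_apply, lap_conv hF hg hc, ih hg.lap hc.lap,
      ← Function.iterate_succ_apply]

lemma pd_comp_sub (hg : Differentiable ℝ g) (x : EuclideanSpace ℝ (Fin d)) (i : Fin d) :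
    pd i (fun t => g (x - t)) = fun t => - pd i g (x - t) := by
  funext t
  have h : HasFDerivAt (fun t : EuclideanSpace ℝ (Fin d) => x - t)
      (-ContinuousLinearMap.id ℝ _) t := (hasFDerivAt_id t).const_sub x
  have := ((hg (x - t)).hasFDerivAt.comp t h).fderiv
  change fderiv ℝ (g ∘ fun t => x - t) t _ = _
  rw [this]
  simp [pd]

lemma lap_comp_sub (hg : ContDiff ℝ (⊤ : ℕ∞) g) (x : EuclideanSpace ℝ (Fin d)) :
    lap (fun t => g (x - t)) = fun t => lap g (x - t) := by
  funext t
  simp only [lap, pd_comp_sub hg.differentiable_of_top, pd_neg,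
    pd_comp_sub (hg.pd _).differentiable_of_top, neg_neg]

lemma iterate_lap_comp_sub (hg : ContDiff ℝ (⊤ : ℕ∞) g) (x : EuclideanSpace ℝ (Fin d)) (k : ℕ) :
    lap^[k] (fun t => g (x - t)) = fun t => lap^[k] g (x - t) := by
  induction k generalizing g with
  | zero => rfl
  | succ k ih =>
    rw [Function.iterate_succ_apply, lap_comp_sub hg, ih hg.lap, ← Function.iterate_succ_apply]

end Convolution

section Kernel

variable {d : ℕ}

lemma locallyIntegrable_norm_rpow (hd : 0 < d) {a : ℝ} (ha : a < d) :
    LocallyIntegrable (fun x : EuclideanSpace ℝ (Fin d) => ‖x‖ ^ (-a)) volume := by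
  refine locallyIntegrable_of_norm_le_rpow (C := 1) (α := a)
    (by rw [finrank_euclideanSpace_fin]; exact hd)
    (by simpa using ha) (Filter.Eventually.of_forall fun x => ?_)
    (by fun_prop : Measurable fun x : EuclideanSpace ℝ (Fin d) => ‖x‖ ^ (-a)).aestronglyMeasurable
  rw [Real.norm_of_nonneg (Real.rpow_nonneg (norm_nonneg _) _), one_mul]

/-- The regularized power `(|y|² + ε²)ˢ`. -/
def regPow (d : ℕ) (ε s : ℝ) : EuclideanSpace ℝ (Fin d) → ℝ :=
  fun y => (‖y‖ ^ 2 + ε ^ 2) ^ s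

variable {ε : ℝ}

lemma contDiff_regPow (hε : 0 < ε) (s : ℝ) : ContDiff ℝ (⊤ : ℕ∞) (regPow d ε s) :=
  ((contDiff_norm_sq ℝ).add contDiff_const).rpow_const_of_ne fun y => by positivity

lemma pd_regPow (hε : 0 < ε) (s : ℝ) (i : Fin d) :
    pd i (regPow d ε s) = fun y => 2 * s * (y i * regPow d ε (s - 1) y) := by
  funext y
  have h1 : HasFDerivAt (fun y : EuclideanSpace ℝ (Fin d) => ‖y‖ ^ 2 + ε ^ 2)
      (2 • (innerSL ℝ y)) y := (hasStrictFDerivAt_norm_sq y).hasFDerivAt.add_const _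
  have h2 := (h1.rpow_const (p := s) (Or.inl (by positivity))).fderiv
  change fderiv ℝ (fun y : EuclideanSpace ℝ (Fin d) => (‖y‖ ^ 2 + ε ^ 2) ^ s) y _ = _
  rw [h2]
  simp [regPow, EuclideanSpace.inner_single_right]
  ring

lemma pd_coord (i : Fin d) : pd i (fun y : EuclideanSpace ℝ (Fin d) => y i) = fun _ => 1 := by
  funext y
  have h := (EuclideanSpace.proj (𝕜 := ℝ) i).hasFDerivAt (x := y)
  change fderiv ℝ (EuclideanSpace.proj (𝕜 := ℝ) i) y _ = _
  rw [h.fderiv]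
  simp

lemma contDiff_coord (i : Fin d) :
    ContDiff ℝ (⊤ : ℕ∞) (fun y : EuclideanSpace ℝ (Fin d) => y i) :=
  (EuclideanSpace.proj (𝕜 := ℝ) i).contDiff

lemma lap_regPow (hε : 0 < ε) (s : ℝ) :
    lap (regPow d ε s) = fun y => -2 * s * ((d + 2 * s - 2) * regPow d ε (s - 1) y
      - 2 * (s - 1) * (ε ^ 2 * regPow d ε (s - 2) y)) := by
  funext y
  have hG := contDiff_regPow (d := d) hε (s - 1)
  have h : ∀ i, pd i (pd i (regPow d ε s)) y = 2 * s * (regPow d ε (s - 1) y +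
      2 * (s - 1) * (y i ^ 2 * regPow d ε (s - 2) y)) := fun i => by
    rw [pd_regPow hε, pd_const_mul ((contDiff_coord i).mul hG).differentiable_of_top,
      pd_mul (contDiff_coord i).differentiable_of_top hG.differentiable_of_top, pd_regPow hε,
      pd_coord, show s - 1 - 1 = s - 2 by ring]
    ring
  have hs : ‖y‖ ^ 2 * regPow d ε (s - 2) y = regPow d ε (s - 1) y
      - ε ^ 2 * regPow d ε (s - 2) y := by
    have : regPow d ε (s - 1) y = regPow d ε (s - 2) y * (‖y‖ ^ 2 + ε ^ 2) := by
      unfold regPow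
      rw [← Real.rpow_add_one (by positivity)]
      ring_nf
    rw [this]; ring
  simp only [lap, h]
  rw [← Finset.mul_sum, Finset.sum_add_distrib, ← Finset.mul_sum, ← Finset.sum_mul,
    ← EuclideanSpace.real_norm_sq_eq, hs]
  simp only [Finset.sum_const, Finset.card_univ, Fintype.card_fin, nsmul_eq_mul]
  ring

lemma regPow_nonneg (s : ℝ) (y : EuclideanSpace ℝ (Fin d)) : 0 ≤ regPow d ε s y :=
  Real.rpow_nonneg (by positivity) _

lemma regPow_le {s : ℝ} (hs : s ≤ 0) {y : EuclideanSpace ℝ (Fin d)} (hy : y ≠ 0) :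
    regPow d ε s y ≤ ‖y‖ ^ (2 * s) := by
  have hy' : 0 < ‖y‖ := norm_pos_iff.2 hy
  rw [Real.rpow_mul hy'.le, Real.rpow_two]
  exact Real.rpow_le_rpow_of_nonpos (by positivity) (by nlinarith) hs

lemma tendsto_regPow (s : ℝ) {y : EuclideanSpace ℝ (Fin d)} (hy : y ≠ 0) :
    Filter.Tendsto (fun ε => regPow d ε s y) (nhdsWithin 0 (Set.Ioi 0))
      (nhds (‖y‖ ^ (2 * s))) := by
  have hy' : 0 < ‖y‖ := norm_pos_iff.2 hy
  have h : Filter.Tendsto (fun ε : ℝ => (‖y‖ ^ 2 + ε ^ 2) ^ s) (nhds 0)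
      (nhds ((‖y‖ ^ 2 + 0 ^ 2) ^ s)) := by
    refine Filter.Tendsto.rpow_const ?_ (Or.inl (by positivity))
    exact (Continuous.tendsto (by fun_prop) 0)
  have h2 : (‖y‖ ^ 2 + 0 ^ 2 : ℝ) ^ s = ‖y‖ ^ (2 * s) := by
    rw [Real.rpow_mul hy'.le, Real.rpow_two]; simp
  rw [h2] at h
  exact h.mono_left nhdsWithin_le_nhds

/-- Dominated convergence against a test function, with a locally integrable power as bound. -/
lemma tendsto_integral_mul_of_le_rpow (hd : 0 < d) {b : ℝ} (hb : b < d)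
    {F : ℝ → EuclideanSpace ℝ (Fin d) → ℝ} {F₀ g : EuclideanSpace ℝ (Fin d) → ℝ}
    (hF : ∀ ε > 0, Continuous (F ε)) (hle : ∀ ε > 0, ∀ y ≠ 0, |F ε y| ≤ ‖y‖ ^ (-b))
    (hlim : ∀ y ≠ 0, Filter.Tendsto (fun ε => F ε y) (nhdsWithin 0 (Set.Ioi 0)) (nhds (F₀ y)))
    (hg : Continuous g) (hc : HasCompactSupport g) :
    Filter.Tendsto (fun ε => ∫ y, F ε y * g y) (nhdsWithin 0 (Set.Ioi 0))
      (nhds (∫ y, F₀ y * g y)) := by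
  have : Nonempty (Fin d) := ⟨⟨0, hd⟩⟩
  have hne : ∀ᵐ y : EuclideanSpace ℝ (Fin d), y ≠ 0 := Measure.ae_ne volume 0
  refine tendsto_integral_filter_of_dominated_convergence (fun y => ‖y‖ ^ (-b) * |g y|) ?_ ?_
    (integrable_mul_of_locallyIntegrable (locallyIntegrable_norm_rpow hd hb) hg.abs hc.norm) ?_
  · filter_upwards [self_mem_nhdsWithin] with ε hε
    exact ((hF ε hε).mul hg).aestronglyMeasurable
  · filter_upwards [self_mem_nhdsWithin] with ε hε
    filter_upwards [hne] with y hy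
    rw [norm_mul, Real.norm_eq_abs, Real.norm_eq_abs]
    exact mul_le_mul_of_nonneg_right (hle ε hε y hy) (abs_nonneg _)
  · filter_upwards [hne] with y hy
    exact (hlim y hy).mul_const _

variable {g : EuclideanSpace ℝ (Fin d) → ℝ}

lemma tendsto_integral_regPow_mul (hd : 0 < d) {s : ℝ} (hs : s ≤ 0) (hsd : -(2 * s) < d)
    (hg : Continuous g) (hc : HasCompactSupport g) :
    Filter.Tendsto (fun ε => ∫ y, regPow d ε s y * g y) (nhdsWithin 0 (Set.Ioi 0))
      (nhds (∫ y, ‖y‖ ^ (2 * s) * g y)) :=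
  tendsto_integral_mul_of_le_rpow hd hsd (fun ε hε => (contDiff_regPow hε s).continuous)
    (fun ε hε y hy => by
      rw [abs_of_nonneg (regPow_nonneg s y), neg_neg]; exact regPow_le hs hy)
    (fun y hy => tendsto_regPow s hy) hg hc

lemma integral_norm_rpow_mul_pd (hd : 0 < d) {a : ℝ} (ha : 0 ≤ a) (had : a + 1 < d)
    (hg : ContDiff ℝ (⊤ : ℕ∞) g) (hc : HasCompactSupport g) (i : Fin d) :
    ∫ y, ‖y‖ ^ (-a) * pd i g y = ∫ y, a * (y i * ‖y‖ ^ (-a - 2)) * g y := by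
  have h1 := tendsto_integral_regPow_mul hd (s := -a / 2) (by linarith) (by linarith)
    (hg.pd i).continuous (hc.pd i)
  have h2 : Filter.Tendsto (fun ε => ∫ y, (y i * regPow d ε (-a / 2 - 1) y) * g y)
      (nhdsWithin 0 (Set.Ioi 0)) (nhds (∫ y, (y i * ‖y‖ ^ (2 * (-a / 2 - 1))) * g y)) := by
    refine tendsto_integral_mul_of_le_rpow hd had
      (fun ε hε => ((contDiff_coord i).mul (contDiff_regPow hε _)).continuous) ?_
      (fun y hy => (tendsto_regPow _ hy).const_mul _) hg.continuous hc
    intro ε hε y hy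
    have hy' : 0 < ‖y‖ := norm_pos_iff.2 hy
    rw [abs_mul, abs_of_nonneg (regPow_nonneg _ y)]
    refine (mul_le_mul (PiLp.norm_apply_le y i) (regPow_le (by linarith) hy)
      (regPow_nonneg _ y) hy'.le).trans (le_of_eq ?_)
    rw [mul_comm, ← Real.rpow_add_one hy'.ne']
    ring_nf
  have h3 : ∀ᶠ ε in nhdsWithin (0 : ℝ) (Set.Ioi 0),
      ∫ y, regPow d ε (-a / 2) y * pd i g y
        = a * ∫ y, (y i * regPow d ε (-a / 2 - 1) y) * g y := by
    filter_upwards [self_mem_nhdsWithin] with ε hε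
    rw [integral_mul_pd (contDiff_regPow hε _) hg hc, pd_regPow hε, ← integral_neg,
      ← integral_const_mul]
    congr 1
    funext y
    ring
  have h4 := tendsto_nhds_unique (h1.congr' h3) (h2.const_mul a)
  have e1 : 2 * (-a / 2) = -a := by ring
  have e2 : 2 * (-a / 2 - 1) = -a - 2 := by ring
  rw [e1, e2, ← integral_const_mul] at h4
  rw [h4]
  simp only [mul_assoc]

lemma integral_regPow_mul_lap (hε : 0 < ε) (a : ℝ) (hg : ContDiff ℝ (⊤ : ℕ∞) g)
    (hc : HasCompactSupport g) :
    ∫ y, regPow d ε (-a / 2) y * lap g y =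
      (a * (d - a - 2) * ∫ y, regPow d ε (-(a + 2) / 2) y * g y) +
      a * (a + 2) * ∫ y, ε ^ 2 * regPow d ε (-(a + 4) / 2) y * g y := by
  have hi : ∀ s, Integrable (fun y => regPow d ε s y * g y) volume := fun s =>
    ((contDiff_regPow hε s).mul hg).continuous.integrable_of_hasCompactSupport hc.mul_left
  have hi2 : Integrable (fun y => ε ^ 2 * regPow d ε (-(a + 4) / 2) y * g y) volume := by
    simpa only [mul_assoc] using (hi _).const_mul (ε ^ 2)
  rw [integral_mul_lap_comm (contDiff_regPow hε _) hg hc, lap_regPow hε, ← integral_const_mul,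
    ← integral_const_mul, ← integral_add ((hi _).const_mul _) (hi2.const_mul _)]
  congr 1
  funext y
  have e1 : -a / 2 - 1 = -(a + 2) / 2 := by ring
  have e2 : -a / 2 - 2 = -(a + 4) / 2 := by ring
  rw [e1, e2]
  ring

lemma integral_norm_rpow_mul_lap (hd : 0 < d) {a : ℝ} (ha : 0 ≤ a) (had : a + 2 < d)
    (hg : ContDiff ℝ (⊤ : ℕ∞) g) (hc : HasCompactSupport g) :
    ∫ y, ‖y‖ ^ (-a) * lap g y = a * (d - a - 2) * ∫ y, ‖y‖ ^ (-(a + 2)) * g y := by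
  have h1 := tendsto_integral_regPow_mul hd (s := -a / 2) (by linarith) (by linarith)
    hg.lap.continuous hc.lap
  have h2 := tendsto_integral_regPow_mul hd (s := -(a + 2) / 2) (by linarith) (by linarith)
    hg.continuous hc
  have h3 : Filter.Tendsto (fun ε => ∫ y, ε ^ 2 * regPow d ε (-(a + 4) / 2) y * g y)
      (nhdsWithin 0 (Set.Ioi 0)) (nhds (∫ y, (0 : ℝ) * g y)) := by
    refine tendsto_integral_mul_of_le_rpow (F := fun ε y => ε ^ 2 * regPow d ε (-(a + 4) / 2) y)
      (F₀ := fun _ => 0) hd had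
      (fun ε hε => (contDiff_const.mul (contDiff_regPow hε _)).continuous) ?_ ?_ hg.continuous hc
    · intro ε hε y hy
      rw [abs_of_nonneg (mul_nonneg (sq_nonneg ε) (regPow_nonneg _ y))]
      have h5 := regPow_le (d := d) (ε := ε) (s := -(a + 2) / 2) (by linarith) hy
      have e1 : 2 * (-(a + 2) / 2) = -(a + 2) := by ring
      rw [e1] at h5
      refine le_trans ?_ h5
      have e3 : -(a + 2) / 2 = -(a + 4) / 2 + 1 := by ring
      have : regPow d ε (-(a + 2) / 2) y = (‖y‖ ^ 2 + ε ^ 2) * regPow d ε (-(a + 4) / 2) y := by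
        unfold regPow
        rw [e3, Real.rpow_add_one (by positivity), mul_comm]
      rw [this]
      exact mul_le_mul_of_nonneg_right (by nlinarith [sq_nonneg ‖y‖]) (regPow_nonneg _ y)
    · intro y hy
      have h6 : Filter.Tendsto (fun ε : ℝ => ε ^ 2) (nhdsWithin 0 (Set.Ioi 0)) (nhds 0) := by
        have : Filter.Tendsto (fun ε : ℝ => ε ^ 2) (nhds 0) (nhds (0 ^ 2)) :=
          (Continuous.tendsto (by fun_prop) 0)
        rw [zero_pow two_ne_zero] at this
        exact this.mono_left nhdsWithin_le_nhds
      simpa using h6.mul (tendsto_regPow (d := d) (-(a + 4) / 2) hy)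
  have h4 := tendsto_nhds_unique (h1.congr' (by
    filter_upwards [self_mem_nhdsWithin] with ε hε
    exact integral_regPow_mul_lap hε a hg hc))
    ((h2.const_mul (a * (d - a - 2))).add (h3.const_mul (a * (a + 2))))
  have e1 : 2 * (-a / 2) = -a := by ring
  have e2 : 2 * (-(a + 2) / 2) = -(a + 2) := by ring
  rw [e1, e2] at h4
  simpa using h4

lemma integral_regPow_one_pos (d : ℕ) :
    Integrable (regPow d 1 (-((d : ℝ) + 2) / 2)) volume ∧
      0 < ∫ y, regPow d 1 (-((d : ℝ) + 2) / 2) y := by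
  have hi : Integrable (regPow d 1 (-((d : ℝ) + 2) / 2)) volume := by
    have := integrable_rpow_neg_one_add_norm_sq (E := EuclideanSpace ℝ (Fin d)) (μ := volume)
      (r := (d : ℝ) + 2) (by simp)
    have h : regPow d 1 (-((d : ℝ) + 2) / 2) =
        fun x => (1 + ‖x‖ ^ 2) ^ (-((d : ℝ) + 2) / 2) := by
      funext x
      simp only [regPow, one_pow, add_comm]
    rwa [h]
  refine ⟨hi, ?_⟩
  have hpos : ∀ y, 0 < regPow d 1 (-((d : ℝ) + 2) / 2) y := fun y =>
    Real.rpow_pos_of_pos (by positivity) _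
  rw [integral_pos_iff_support_of_nonneg (fun y => (hpos y).le) hi,
    show Function.support (regPow d 1 (-((d : ℝ) + 2) / 2)) = Set.univ from
      Set.eq_univ_of_forall fun y => (hpos y).ne']
  exact Measure.measure_univ_pos.2 (NeZero.ne _)

/-- The Newtonian kernel is a fundamental solution of the Laplacian. -/
lemma integral_newton_mul_lap (hd : 2 < d) : ∃ c : ℝ, 0 < c ∧
    ∀ g : EuclideanSpace ℝ (Fin d) → ℝ, ContDiff ℝ (⊤ : ℕ∞) g → HasCompactSupport g →
      ∫ y, ‖y‖ ^ (-((d : ℝ) - 2)) * lap g y = c * g 0 := by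
  have hd0 : 0 < d := by omega
  have hd2 : (2 : ℝ) < d := by exact_mod_cast hd
  obtain ⟨hi, hpos⟩ := integral_regPow_one_pos d
  refine ⟨((d : ℝ) - 2) * d * ∫ y, regPow d 1 (-((d : ℝ) + 2) / 2) y,
    mul_pos (mul_pos (by linarith) (by linarith)) hpos, fun g hg hc => ?_⟩
  have h1 := tendsto_integral_regPow_mul hd0 (s := -((d : ℝ) - 2) / 2) (by linarith)
    (by linarith) hg.lap.continuous hc.lap
  obtain ⟨M, hM⟩ := hg.continuous.bounded_above_of_compact_support hc
  have h2 : Filter.Tendsto (fun ε : ℝ => ∫ z, regPow d 1 (-((d : ℝ) + 2) / 2) z * g (ε • z))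
      (nhdsWithin 0 (Set.Ioi 0)) (nhds (∫ z, regPow d 1 (-((d : ℝ) + 2) / 2) z * g 0)) := by
    refine tendsto_integral_filter_of_dominated_convergence
      (fun z => regPow d 1 (-((d : ℝ) + 2) / 2) z * M) ?_ ?_ (hi.mul_const M) ?_
    · exact Filter.Eventually.of_forall fun ε =>
        ((contDiff_regPow one_pos _).continuous.mul
          (hg.continuous.comp (continuous_const_smul ε))).aestronglyMeasurable
    · refine Filter.Eventually.of_forall fun ε => Filter.Eventually.of_forall fun z => ?_
      rw [norm_mul, Real.norm_of_nonneg (regPow_nonneg _ z)]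
      exact mul_le_mul_of_nonneg_left (hM _) (regPow_nonneg _ z)
    · refine Filter.Eventually.of_forall fun z => Filter.Tendsto.const_mul _ ?_
      have : Filter.Tendsto (fun ε : ℝ => g (ε • z)) (nhds 0) (nhds (g ((0 : ℝ) • z))) :=
        (hg.continuous.comp (by fun_prop : Continuous fun ε : ℝ => ε • z)).tendsto 0
      rw [zero_smul] at this
      exact this.mono_left nhdsWithin_le_nhds
  have h3 : ∀ ε : ℝ, 0 < ε → ∫ y, ε ^ 2 * regPow d ε (-((d : ℝ) - 2 + 4) / 2) y * g y =
      ∫ z, regPow d 1 (-((d : ℝ) + 2) / 2) z * g (ε • z) := by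
    intro ε hε
    have h := Measure.integral_comp_smul (volume : Measure (EuclideanSpace ℝ (Fin d)))
      (fun y => ε ^ 2 * regPow d ε (-((d : ℝ) - 2 + 4) / 2) y * g y) ε
    have hεd : (0 : ℝ) < ε ^ d := pow_pos hε d
    rw [finrank_euclideanSpace_fin, abs_of_pos (inv_pos.2 hεd), smul_eq_mul,
      eq_inv_mul_iff_mul_eq₀ hεd.ne', ← integral_const_mul] at h
    rw [← h]
    congr 1
    funext z
    have h5 : ε ^ d * (ε ^ 2 * regPow d ε (-((d : ℝ) - 2 + 4) / 2) (ε • z)) =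
        regPow d 1 (-((d : ℝ) + 2) / 2) z := by
      unfold regPow
      have e1 : ‖ε • z‖ ^ 2 + ε ^ 2 = ε ^ 2 * (‖z‖ ^ 2 + 1 ^ 2) := by
        rw [norm_smul, Real.norm_of_nonneg hε.le]; ring
      have e2 : -((d : ℝ) - 2 + 4) / 2 = -((d : ℝ) + 2) / 2 := by ring
      rw [e1, e2, Real.mul_rpow (by positivity) (by positivity), ← Real.rpow_two,
        ← Real.rpow_mul hε.le, ← Real.rpow_natCast ε d, ← mul_assoc, ← mul_assoc,
        ← Real.rpow_add hε, ← Real.rpow_add hε]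
      have e3 : (d : ℝ) + 2 + 2 * (-((d : ℝ) + 2) / 2) = 0 := by ring
      rw [e3, Real.rpow_zero, one_mul]
    rw [← h5]
    ring
  have h4 := tendsto_nhds_unique (h1.congr' (by
    filter_upwards [self_mem_nhdsWithin] with ε hε
    rw [integral_regPow_mul_lap hε _ hg hc, h3 ε hε]
    have e1 : (d : ℝ) - (d - 2) - 2 = 0 := by ring
    rw [e1, mul_zero, zero_mul, zero_add])) (h2.const_mul _)
  have e1 : 2 * (-((d : ℝ) - 2) / 2) = -((d : ℝ) - 2) := by ring
  rw [e1, integral_mul_const] at h4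
  rw [h4]
  ring

/-- The Riesz kernel `|x|^{2 m - d}` is, up to a constant, a fundamental solution of `(-Δ)ᵐ`. -/
lemma integral_riesz_mul_iterate_lap {m : ℕ} (hm : 1 ≤ m) (hmd : 2 * m < d) : ∃ c : ℝ, 0 < c ∧
    ∀ g : EuclideanSpace ℝ (Fin d) → ℝ, ContDiff ℝ (⊤ : ℕ∞) g → HasCompactSupport g →
      ∫ y, ‖y‖ ^ (-((d : ℝ) - 2 * m)) * lap^[m] g y = c * g 0 := by
  induction m, hm using Nat.le_induction with
  | base => simpa using integral_newton_mul_lap (d := d) (by omega)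
  | succ m hm ih =>
    obtain ⟨c, hc, h⟩ := ih (by omega)
    have hm' : (1 : ℝ) ≤ m := by exact_mod_cast hm
    have hmd' : 2 * ((m : ℝ) + 1) < d := by exact_mod_cast hmd
    refine ⟨((d : ℝ) - 2 * (m + 1)) * (2 * m) * c,
      mul_pos (mul_pos (by linarith) (by linarith)) hc, fun g hg hgc => ?_⟩
    push_cast
    rw [Function.iterate_succ_apply', integral_norm_rpow_mul_lap (by omega) (by linarith)
      (by linarith) (hg.iterate_lap m) (hgc.iterate_lap m)]
    have e1 : (d : ℝ) - 2 * (m + 1) + 2 = d - 2 * m := by ring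
    rw [e1, h g hg hgc]
    ring

lemma iterate_lap_conv_riesz {m : ℕ} (hm : 1 ≤ m) (hmd : 2 * m < d) : ∃ c : ℝ, 0 < c ∧
    ∀ g : EuclideanSpace ℝ (Fin d) → ℝ, ContDiff ℝ (⊤ : ℕ∞) g → HasCompactSupport g →
      lap^[m] (conv (fun y => ‖y‖ ^ (-((d : ℝ) - 2 * m))) g) = fun x => c * g x := by
  obtain ⟨c, hc, h⟩ := integral_riesz_mul_iterate_lap hm hmd
  refine ⟨c, hc, fun g hg hgc => ?_⟩
  have hm' : (1 : ℝ) ≤ m := by exact_mod_cast hm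
  rw [iterate_lap_conv (locallyIntegrable_norm_rpow (by omega) (by linarith)) hg hgc]
  funext x
  have := h _ (contDiff_comp_sub hg x) (hasCompactSupport_comp_sub hgc x)
  rw [iterate_lap_comp_sub hg] at this
  simpa [conv] using this

end Kernel

section Decay

variable {d : ℕ} {f g : EuclideanSpace ℝ (Fin d) → ℝ}

lemma exists_abs_dL_le (hf : ContDiff ℝ (⊤ : ℕ∞) f) (hc : HasCompactSupport f) (n : ℕ) :
    ∃ M : ℝ, 0 ≤ M ∧ ∀ L : List (Fin d), L.length ≤ n → ∀ x, |dL L f x| ≤ M := by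
  have h : ∀ k : ℕ, ∃ M : ℝ, ∀ x, ‖iteratedFDeriv ℝ k f x‖ ≤ M := fun k =>
    (hf.continuous_iteratedFDeriv (by exact_mod_cast le_top)).bounded_above_of_compact_support
      (hc.iteratedFDeriv k)
  choose M hM using h
  have hM0 : ∀ k, 0 ≤ M k := fun k => (norm_nonneg _).trans (hM k 0)
  refine ⟨∑ k ∈ Finset.range (n + 1), M k, Finset.sum_nonneg fun k _ => hM0 k, fun L hL x => ?_⟩
  exact (abs_dL_le_norm_iteratedFDeriv hf L x).trans ((hM _ x).trans
    (Finset.single_le_sum (fun k _ => hM0 k) (Finset.mem_range.2 (by omega))))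

lemma abs_dL_mul_le (hf : ContDiff ℝ (⊤ : ℕ∞) f) (hg : ContDiff ℝ (⊤ : ℕ∞) g)
    {M N r : ℝ} (hM : 0 ≤ M) (hN : 0 ≤ N) (hr : 0 ≤ r) (x : EuclideanSpace ℝ (Fin d))
    (L : List (Fin d)) (hfL : ∀ A : List (Fin d), A.length ≤ L.length →
      |dL A f x| ≤ M * r ^ A.length)
    (hgL : ∀ A : List (Fin d), A.length ≤ L.length → |dL A g x| ≤ N * r ^ A.length) :
    |dL L (fun x => f x * g x) x| ≤ 2 ^ L.length * (M * N) * r ^ L.length := by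
  induction L generalizing f g M N with
  | nil =>
    have h1 := hfL [] le_rfl
    have h2 := hgL [] le_rfl
    simp only [dL, List.length_nil, pow_zero, mul_one, one_mul] at h1 h2 ⊢
    rw [abs_mul]
    exact mul_le_mul h1 h2 (abs_nonneg _) hM
  | cons i L ih =>
    have hsucc : ∀ (h : EuclideanSpace ℝ (Fin d) → ℝ) (P : ℝ), ContDiff ℝ (⊤ : ℕ∞) h →
        (∀ A : List (Fin d), A.length ≤ (i :: L).length → |dL A h x| ≤ P * r ^ A.length) →
        ∀ A : List (Fin d), A.length ≤ L.length → |dL A (pd i h) x| ≤ (P * r) * r ^ A.length := by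
      intro h P hh hP A hA
      have := hP (i :: A) (by simpa using hA)
      rw [dL_pd hh]
      simpa [dL, pow_succ', mul_assoc] using this
    have hle : ∀ A : List (Fin d), A.length ≤ L.length → A.length ≤ (i :: L).length :=
      fun A hA => hA.trans (by simp)
    have e : dL (i :: L) (fun x => f x * g x) x =
        dL L (fun x => f x * pd i g x) x + dL L (fun x => pd i f x * g x) x := by
      rw [dL, ← dL_pd (hf.mul hg), pd_mul hf.differentiable_of_top hg.differentiable_of_top]
      have := congrFun (dL_sum (s := Finset.univ)
        (F := fun b : Bool => bif b then (fun x => f x * pd i g x) else fun x => pd i f x * g x)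
        (fun b => by cases b; exacts [(hf.pd i).mul hg, hf.mul (hg.pd i)]) L) x
      simpa using this
    have h1 := ih hf (hg.pd i) hM (mul_nonneg hN hr) (fun A hA => hfL A (hle A hA))
      (hsucc g N hg hgL)
    have h2 := ih (hf.pd i) hg (mul_nonneg hM hr) hN (hsucc f M hf hfL)
      (fun A hA => hgL A (hle A hA))
    rw [e]
    refine (abs_add_le _ _).trans ((add_le_add h1 h2).trans (le_of_eq ?_))
    rw [List.length_cons]
    ring

/-- A test function that agrees with `|x|^{-a}` on an annulus. -/
lemma exists_annulus_cutoff (d : ℕ) (a : ℝ) : ∃ κ : EuclideanSpace ℝ (Fin d) → ℝ,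
    ContDiff ℝ (⊤ : ℕ∞) κ ∧ HasCompactSupport κ ∧
      ∀ x, 1 / 4 ≤ ‖x‖ → ‖x‖ ≤ 13 / 4 → κ x = ‖x‖ ^ (-a) := by
  let b : ContDiffBump (0 : EuclideanSpace ℝ (Fin d)) := ⟨1 / 8, 1 / 4, by norm_num, by norm_num⟩
  let B : ContDiffBump (0 : EuclideanSpace ℝ (Fin d)) := ⟨13 / 4, 4, by norm_num, by norm_num⟩
  refine ⟨fun x => B x * ((1 - b x) * ‖x‖ ^ (-a)), ?_, B.hasCompactSupport.mul_right, ?_⟩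
  · refine B.contDiff.mul (contDiff_iff_contDiffAt.2 fun x => ?_)
    by_cases hx : x = 0
    · subst hx
      refine (contDiffAt_const (c := (0 : ℝ))).congr_of_eventuallyEq ?_
      filter_upwards [b.eventuallyEq_one] with y hy
      simp [hy]
    · exact (contDiffAt_const.sub b.contDiff.contDiffAt).mul
        ((contDiffAt_norm ℝ hx).rpow_const_of_ne (norm_ne_zero_iff.2 hx))
  · intro x h1 h2
    have hB : B x = 1 := B.one_of_mem_closedBall (by simpa using h2)
    have hb : b x = 0 := b.zero_of_le_dist (by rw [dist_zero_right]; exact h1)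
    simp [hB, hb]

/-- Derivatives of a potential decay at the natural rate away from its source. -/
lemma exists_abs_dL_conv_norm_rpow_le {μ : EuclideanSpace ℝ (Fin d) → ℝ} (a : ℝ)
    (hμ : ContDiff ℝ (⊤ : ℕ∞) μ) (hμc : HasCompactSupport μ) (n : ℕ) :
    ∃ M R₀ : ℝ, 0 ≤ M ∧ 0 < R₀ ∧ ∀ R, R₀ ≤ R → ∀ x, R / 2 < ‖x‖ → ‖x‖ < 3 * R →
      ∀ L : List (Fin d), L.length ≤ n →
        |dL L (conv (fun y => ‖y‖ ^ (-a)) μ) x| ≤ M * R ^ (-a) * R⁻¹ ^ L.length := by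
  obtain ⟨κ, hκ, hκc, hκe⟩ := exists_annulus_cutoff d a
  obtain ⟨M, hM, hMκ⟩ := exists_abs_dL_le hκ hκc n
  obtain ⟨r, hr⟩ := hμc.isCompact.isBounded.subset_closedBall 0
  refine ⟨(∫ t, |μ t|) * M, 4 * max r 1, mul_nonneg (integral_nonneg fun _ => abs_nonneg _) hM,
    by positivity, fun R hR x hx1 hx2 L hL => ?_⟩
  have hR0 : 0 < R := lt_of_lt_of_le (by positivity) hR
  have hrR : r ≤ R / 4 := by linarith [le_max_left r 1]
  set κR : EuclideanSpace ℝ (Fin d) → ℝ := fun y => R ^ (-a) * κ (R⁻¹ • y) with hκR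
  have hcomp : ContDiff ℝ (⊤ : ℕ∞) fun y : EuclideanSpace ℝ (Fin d) => κ (R⁻¹ • y) :=
    hκ.comp (contDiff_const_smul _)
  have hκRs : ContDiff ℝ (⊤ : ℕ∞) κR := contDiff_const.mul hcomp
  have hκRc : HasCompactSupport κR :=
    (hκc.comp_homeomorph (Homeomorph.smulOfNeZero R⁻¹ (inv_ne_zero hR0.ne'))).mul_left
  have hμl : LocallyIntegrable μ volume := hμ.continuous.locallyIntegrable
  have hann : ∀ᶠ y in nhds x, conv (fun y => ‖y‖ ^ (-a)) μ y = conv μ κR y := by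
    have h1 : ∀ᶠ y : EuclideanSpace ℝ (Fin d) in nhds x, R / 2 < ‖y‖ :=
      continuous_norm.continuousAt.eventually (lt_mem_nhds hx1)
    have h2 : ∀ᶠ y : EuclideanSpace ℝ (Fin d) in nhds x, ‖y‖ < 3 * R :=
      continuous_norm.continuousAt.eventually (gt_mem_nhds hx2)
    filter_upwards [h1, h2] with y hy1 hy2
    unfold conv
    rw [← integral_sub_left_eq_self _ volume y]
    congr 1
    funext t
    rw [sub_sub_cancel, mul_comm]
    by_cases ht : μ t = 0
    · simp [ht]
    · have htr : ‖t‖ ≤ R / 4 := by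
        have := hr (subset_tsupport μ ht)
        rw [mem_closedBall_zero_iff] at this
        exact this.trans hrR
      have h3 : R / 4 ≤ ‖y - t‖ := by linarith [norm_sub_norm_le y t]
      have h4 : ‖y - t‖ ≤ 13 * R / 4 := by linarith [norm_sub_le y t]
      have h5 : ‖R⁻¹ • (y - t)‖ = R⁻¹ * ‖y - t‖ := by
        rw [norm_smul, Real.norm_of_nonneg (inv_nonneg.2 hR0.le)]
      have h6 := hκe (R⁻¹ • (y - t))
        (by rw [h5, inv_mul_eq_div, le_div_iff₀ hR0]; linarith)
        (by rw [h5, inv_mul_eq_div, div_le_iff₀ hR0]; linarith)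
      simp only [hκR]
      rw [h6, h5, ← Real.mul_rpow hR0.le (by positivity), mul_inv_cancel_left₀ hR0.ne']
  rw [(Filter.EventuallyEq.dL hann L).eq_of_nhds, dL_conv hμl hκRs hκRc]
  have hdL : ∀ y, |dL L κR y| ≤ R ^ (-a) * (R⁻¹ ^ L.length * M) := fun y => by
    rw [hκR, dL_const_mul hcomp, dL_comp_smul hκ]
    simp only [abs_mul]
    rw [abs_of_nonneg (Real.rpow_nonneg hR0.le _), abs_of_nonneg (by positivity)]
    gcongr
    exact hMκ L hL _
  have hμi : Integrable (fun t => |μ t|) volume :=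
    (hμ.continuous.integrable_of_hasCompactSupport hμc).abs
  calc |∫ t, μ t * dL L κR (x - t)|
      ≤ ∫ t, |μ t| * (R ^ (-a) * (R⁻¹ ^ L.length * M)) := by
        rw [← Real.norm_eq_abs]
        refine norm_integral_le_of_norm_le (hμi.mul_const _)
          (Filter.Eventually.of_forall fun t => ?_)
        rw [norm_mul, Real.norm_eq_abs, Real.norm_eq_abs]
        exact mul_le_mul_of_nonneg_left (hdL _) (abs_nonneg _)
    _ = _ := by rw [integral_mul_const]; ring

/-- A decaying potential is approximated, in energy, by compactly supported ones. -/
lemma exists_tendsto_energy {φ : EuclideanSpace ℝ (Fin d) → ℝ} {m : ℕ} {a : ℝ} (ha : 0 < a)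
    (had : (d : ℝ) = a + 2 * m) (hφ : ContDiff ℝ (⊤ : ℕ∞) φ)
    (hφc : HasCompactSupport (lap^[m] φ)) {M R₀ : ℝ} (hM : 0 ≤ M)
    (hdec : ∀ R, R₀ ≤ R → ∀ x, R / 2 < ‖x‖ → ‖x‖ < 3 * R →
      ∀ L : List (Fin d), L.length ≤ 2 * m → |dL L φ x| ≤ M * R ^ (-a) * R⁻¹ ^ L.length) :
    ∃ ψ : ℝ → EuclideanSpace ℝ (Fin d) → ℝ,
      (∀ R, 0 < R → ContDiff ℝ (⊤ : ℕ∞) (ψ R) ∧ HasCompactSupport (ψ R) ∧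
        ∀ x, ‖x‖ < R → ψ R =ᶠ[nhds x] φ) ∧
      Filter.Tendsto (fun R => ∫ x, lap^[m] (ψ R) x * ψ R x) Filter.atTop
        (nhds (∫ x, lap^[m] φ x * φ x)) := by
  let χ : ContDiffBump (0 : EuclideanSpace ℝ (Fin d)) := ⟨1, 2, one_pos, one_lt_two⟩
  have hχ : ContDiff ℝ (⊤ : ℕ∞) χ := χ.contDiff
  obtain ⟨N, hN, hNχ⟩ := exists_abs_dL_le hχ χ.hasCompactSupport (2 * m)
  obtain ⟨r, hr⟩ := hφc.isCompact.isBounded.subset_closedBall 0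
  have hχR : ∀ R : ℝ, ContDiff ℝ (⊤ : ℕ∞)
      fun x : EuclideanSpace ℝ (Fin d) => χ (R⁻¹ • x) := fun R =>
    hχ.comp (contDiff_const_smul _)
  have hnorm : ∀ R, 0 < R → ∀ x : EuclideanSpace ℝ (Fin d), ‖R⁻¹ • x‖ = ‖x‖ / R := by
    intro R hR x
    rw [norm_smul, Real.norm_of_nonneg (inv_nonneg.2 hR.le), inv_mul_eq_div]
  set ψ : ℝ → EuclideanSpace ℝ (Fin d) → ℝ := fun R x => χ (R⁻¹ • x) * φ x with hψ
  have hψs : ∀ R, ContDiff ℝ (⊤ : ℕ∞) (ψ R) := fun R => (hχR R).mul hφ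
  have hψc : ∀ R, 0 < R → HasCompactSupport (ψ R) := fun R hR =>
    (χ.hasCompactSupport.comp_homeomorph
      (Homeomorph.smulOfNeZero R⁻¹ (inv_ne_zero hR.ne'))).mul_right
  have hψe : ∀ R, 0 < R → ∀ x, ‖x‖ < R → ψ R =ᶠ[nhds x] φ := fun R hR x hx => by
    filter_upwards [continuous_norm.continuousAt.eventually (gt_mem_nhds hx)] with y hy
    have : χ (R⁻¹ • y) = 1 := χ.one_of_mem_closedBall (by
      rw [mem_closedBall_zero_iff, hnorm R hR, div_le_one hR]; exact hy.le)
    simp [hψ, this]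
  refine ⟨ψ, fun R hR => ⟨hψs R, hψc R hR, hψe R hR⟩, ?_⟩
  set D : ℝ := (d : ℝ) ^ m * 2 ^ (2 * m) * (N * M) * (N * M) * 3 ^ d *
    volume.real (Metric.ball (0 : EuclideanSpace ℝ (Fin d)) 1) with hD
  have hlim : Filter.Tendsto (fun R : ℝ => D * R ^ (-a)) Filter.atTop (nhds 0) := by
    simpa using (tendsto_rpow_neg_atTop ha).const_mul D
  rw [tendsto_iff_norm_sub_tendsto_zero]
  refine squeeze_zero' (Filter.Eventually.of_forall fun _ => norm_nonneg _) ?_ hlim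
  filter_upwards [Filter.eventually_ge_atTop R₀, Filter.eventually_gt_atTop r,
    Filter.eventually_gt_atTop 0] with R hR0 hRr hR
  have hi1 : Integrable (fun x => lap^[m] (ψ R) x * ψ R x) volume :=
    (((hψs R).iterate_lap m).mul (hψs R)).continuous.integrable_of_hasCompactSupport
      (hψc R hR).mul_left
  have hi2 : Integrable (fun x => lap^[m] φ x * φ x) volume :=
    ((hφ.iterate_lap m).mul hφ).continuous.integrable_of_hasCompactSupport hφc.mul_right
  rw [← integral_sub hi1 hi2]
  have hφ0 : ∀ x : EuclideanSpace ℝ (Fin d), R ≤ ‖x‖ → lap^[m] φ x = 0 := fun x hx => by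
    by_contra h
    have := hr (subset_tsupport _ h)
    rw [mem_closedBall_zero_iff] at this
    linarith
  have hsub : ∀ x, x ∉ Metric.ball (0 : EuclideanSpace ℝ (Fin d)) (3 * R) →
      lap^[m] (ψ R) x * ψ R x - lap^[m] φ x * φ x = 0 := fun x hx => by
    rw [mem_ball_zero_iff, not_lt] at hx
    have : χ (R⁻¹ • x) = 0 := χ.zero_of_le_dist (by
      rw [dist_zero_right, hnorm R hR, le_div_iff₀ hR]
      change 2 * R ≤ _
      linarith)
    simp [hφ0 x (by linarith), hψ, this]
  rw [← setIntegral_eq_integral_of_forall_compl_eq_zero hsub]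
  have hRa : 0 ≤ R ^ (-a) := Real.rpow_nonneg hR.le _
  have hbound : ∀ x ∈ Metric.ball (0 : EuclideanSpace ℝ (Fin d)) (3 * R),
      ‖lap^[m] (ψ R) x * ψ R x - lap^[m] φ x * φ x‖ ≤
        (d : ℝ) ^ m * (2 ^ (2 * m) * (N * (M * R ^ (-a))) * R⁻¹ ^ (2 * m)) *
          (N * (M * R ^ (-a))) := by
    intro x hx
    rw [mem_ball_zero_iff] at hx
    rcases lt_or_ge ‖x‖ R with h | h
    · have he := hψe R hR x h
      rw [(he.iterate_lap m).eq_of_nhds, he.eq_of_nhds, sub_self, norm_zero]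
      positivity
    · have hL : ∀ L : List (Fin d), L.length ≤ 2 * m →
          |dL L (ψ R) x| ≤ 2 ^ L.length * (N * (M * R ^ (-a))) * R⁻¹ ^ L.length := by
        intro L hL
        refine abs_dL_mul_le (hχR R) hφ hN (by positivity) (by positivity) x L
          (fun A hA => ?_) fun A hA => hdec R hR0 x (by linarith) hx A (hA.trans hL)
        rw [dL_comp_smul hχ, abs_mul, abs_of_nonneg (by positivity), mul_comm]
        exact mul_le_mul_of_nonneg_right (hNχ A (hA.trans hL) _) (by positivity)
      have h1 := abs_iterate_lap_le (hψs R) m x fun L hLm => by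
        have := hL L hLm.le
        rw [hLm] at this
        exact this
      have h2 := hL [] (by simp)
      simp only [dL, List.length_nil, pow_zero, mul_one, one_mul] at h2
      rw [hφ0 x h, zero_mul, sub_zero, norm_mul, Real.norm_eq_abs, Real.norm_eq_abs]
      exact mul_le_mul h1 h2 (abs_nonneg _) (by positivity)
  refine (norm_setIntegral_le_of_norm_le_const measure_ball_lt_top hbound).trans (le_of_eq ?_)
  have hvol : volume.real (Metric.ball (0 : EuclideanSpace ℝ (Fin d)) (3 * R)) =
      (3 * R) ^ d * volume.real (Metric.ball (0 : EuclideanSpace ℝ (Fin d)) 1) := by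
    rw [measureReal_def, Measure.addHaar_ball_of_pos _ _ (by positivity : 0 < 3 * R),
      finrank_euclideanSpace_fin, ENNReal.toReal_mul, ENNReal.toReal_ofReal (by positivity),
      measureReal_def]
  have hpow : R ^ (-a) * R⁻¹ ^ (2 * m) * R ^ d = 1 := by
    rw [inv_pow, ← Real.rpow_natCast R d, ← Real.rpow_natCast R (2 * m), ← Real.rpow_neg hR.le,
      ← Real.rpow_add hR, ← Real.rpow_add hR, had]
    push_cast
    rw [show -a + -(2 * (m : ℝ)) + (a + 2 * m) = 0 by ring, Real.rpow_zero]
  rw [hvol, hD, mul_pow]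
  linear_combination ((d : ℝ) ^ m * 2 ^ (2 * m) * (N * M) * (N * M) * 3 ^ d *
    volume.real (Metric.ball (0 : EuclideanSpace ℝ (Fin d)) 1) * R ^ (-a)) * hpow

end Decay

section Potential

variable {d : ℕ} {μ : EuclideanSpace ℝ (Fin d) → ℝ}

lemma locallyIntegrable_coord_mul_norm_rpow (hd : 0 < d) {a : ℝ} (had : a + 1 < d) (i : Fin d) :
    LocallyIntegrable (fun t : EuclideanSpace ℝ (Fin d) => t i * ‖t‖ ^ (-a - 2)) volume := by
  refine locallyIntegrable_of_norm_le_rpow (C := 1) (α := a + 1)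
    (by rw [finrank_euclideanSpace_fin]; exact hd) (by simpa using had)
    (Filter.Eventually.of_forall fun t => ?_)
    (by fun_prop : Measurable fun t : EuclideanSpace ℝ (Fin d) =>
      t i * ‖t‖ ^ (-a - 2)).aestronglyMeasurable
  rcases eq_or_ne t 0 with rfl | ht
  · simpa using Real.rpow_nonneg le_rfl _
  have ht' : 0 < ‖t‖ := norm_pos_iff.2 ht
  rw [norm_mul, Real.norm_of_nonneg (Real.rpow_nonneg ht'.le _), one_mul]
  refine (mul_le_mul_of_nonneg_right (PiLp.norm_apply_le t i)
    (Real.rpow_nonneg ht'.le _)).trans (le_of_eq ?_)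
  rw [mul_comm, ← Real.rpow_add_one ht'.ne']
  ring_nf

lemma integrable_gradient_kernel_mul (hd : 0 < d) {a : ℝ} (had : a + 1 < d)
    (hμ : ContDiff ℝ (⊤ : ℕ∞) μ) (hμc : HasCompactSupport μ)
    (x : EuclideanSpace ℝ (Fin d)) (i : Fin d) :
    Integrable (fun y => (x i - y i) * ‖x - y‖ ^ (-a - 2) * μ y) volume := by
  have := (integrable_mul_of_locallyIntegrable (locallyIntegrable_coord_mul_norm_rpow hd had i)
    (contDiff_comp_sub hμ x).continuous (hasCompactSupport_comp_sub hμc x)).comp_sub_left x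
  simpa using this

/-- The gradient of the potential is the convolution with the gradient of the kernel. -/
lemma pd_conv_norm_rpow (hd : 0 < d) {a : ℝ} (ha : 0 ≤ a) (had : a + 1 < d)
    (hμ : ContDiff ℝ (⊤ : ℕ∞) μ) (hμc : HasCompactSupport μ)
    (x : EuclideanSpace ℝ (Fin d)) (i : Fin d) :
    pd i (conv (fun y => ‖y‖ ^ (-a)) μ) x =
      -a * ∫ y, (x i - y i) * ‖x - y‖ ^ (-a - 2) * μ y := by
  have h := integral_norm_rpow_mul_pd hd ha had (contDiff_comp_sub hμ x)
    (hasCompactSupport_comp_sub hμc x) i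
  rw [pd_comp_sub hμ.differentiable_of_top] at h
  rw [pd_conv (locallyIntegrable_norm_rpow hd (by linarith)) hμ hμc,
    ← integral_sub_left_eq_self _ volume x]
  simp only [mul_neg, integral_neg, sub_sub_cancel] at h ⊢
  rw [conv, ← neg_inj, h, neg_mul, neg_neg, ← integral_const_mul]
  congr 1
  funext t
  simp only [PiLp.sub_apply, sub_sub_cancel]
  ring

lemma integral_gradient_kernel (hd : 0 < d) {a : ℝ} (ha : 0 ≤ a) (had : a + 1 < d)
    (hμ : ContDiff ℝ (⊤ : ℕ∞) μ) (hμc : HasCompactSupport μ)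
    (x v : EuclideanSpace ℝ (Fin d)) :
    ∫ y, μ x * μ y * (-a * ‖x - y‖ ^ (-a - 2) * ∑ i, v i * (x i - y i)) =
      μ x * ∑ i, v i * pd i (conv (fun y => ‖y‖ ^ (-a)) μ) x := by
  simp only [pd_conv_norm_rpow hd ha had hμ hμc]
  simp only [← integral_const_mul]
  rw [← integral_finsetSum (f := fun i y =>
    v i * (-a * ((x i - y i) * ‖x - y‖ ^ (-a - 2) * μ y))) _ fun i _ =>
      ((integrable_gradient_kernel_mul hd had hμ hμc x i).const_mul _).const_mul _,
    ← integral_const_mul]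
  congr 1
  funext y
  simp only [Finset.mul_sum]
  refine Finset.sum_congr rfl fun i _ => ?_
  ring

lemma integral_kernel (a : ℝ) (x : EuclideanSpace ℝ (Fin d)) :
    ∫ y, μ x * μ y * ‖x - y‖ ^ (-a) = μ x * conv (fun y => ‖y‖ ^ (-a)) μ x := by
  rw [conv, ← integral_sub_left_eq_self _ volume x, ← integral_const_mul]
  congr 1
  funext y
  rw [sub_sub_cancel]
  ring

end Potential

/-- Modulated interaction energy estimate for `K(x) = |x|^{-α}` with
`α = d - 2m`, `m ≥ 2`, `d > 2m` (so `α ≡ d mod 2`, `0 < α < d-2`): there is `C > 0`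
depending only on `d, m` such that for any `μ ∈ C_c^∞(ℝ^d)` and `u ∈ C_c^∞(ℝ^d;ℝ^d)`,
`T(μ,u) ≤ C (‖∇u‖_{L^∞} + ‖∇^m u‖_{L^{d/(m-1)}}) E(μ)`. -/
theorem stmt_3 (d m : ℕ) (hm : 2 ≤ m) (hd : 2 * m < d) (α : ℝ)
    (hα : α = (d : ℝ) - 2 * m) :
    ∃ C : ℝ, 0 < C ∧
      ∀ μ : EuclideanSpace ℝ (Fin d) → ℝ,
        ContDiff ℝ (⊤ : ℕ∞) μ → HasCompactSupport μ →
        ∀ u : EuclideanSpace ℝ (Fin d) → EuclideanSpace ℝ (Fin d),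
          ContDiff ℝ (⊤ : ℕ∞) u → HasCompactSupport u →
          (∫ x, ∫ y, μ x * μ y *
              (-α * ‖x - y‖ ^ (-α - 2) * ∑ i, u x i * (x i - y i)))
            ≤ C * ((⨆ x, ‖fderiv ℝ u x‖)
                  + sobSeminorm d m ((d : ℝ) / ((m : ℝ) - 1)) u) *
              ∫ x, ∫ y, μ x * μ y * ‖x - y‖ ^ (-α) := by
  have hd0 : 0 < d := by omega
  have hm' : (2 : ℝ) ≤ m := by exact_mod_cast hm
  have hd' : (2 : ℝ) * m < d := by exact_mod_cast hd
  obtain ⟨C, hC, hmain⟩ := exists_abs_integral_iterate_lap_mul_transport_le (d := d) hm hd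
  obtain ⟨c, hc, hriesz⟩ := iterate_lap_conv_riesz (d := d) (m := m) (by omega) hd
  refine ⟨C + 1, by positivity, fun μ hμ hμc u hu huc => ?_⟩
  simp only [integral_gradient_kernel hd0 (by linarith : 0 ≤ α) (by linarith) hμ hμc,
    integral_kernel]
  set N : ℝ := (⨆ x, ‖fderiv ℝ u x‖) + sobSeminorm d m ((d : ℝ) / ((m : ℝ) - 1)) u
  have hN : 0 ≤ N := add_nonneg (Real.iSup_nonneg fun x => norm_nonneg _) (sobSeminorm_nonneg _ _)
  have hlap := hriesz μ hμ hμc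
  rw [← hα] at hlap
  obtain ⟨M, R₀, hM, -, hdec⟩ := exists_abs_dL_conv_norm_rpow_le α hμ hμc (2 * m)
  have hφ : ContDiff ℝ (⊤ : ℕ∞) (conv (fun y => ‖y‖ ^ (-α)) μ) :=
    ContDiff.conv (locallyIntegrable_norm_rpow hd0 (by linarith)) hμ hμc
  set φ := conv (fun y => ‖y‖ ^ (-α)) μ
  obtain ⟨ψ, hψ, hlim⟩ := exists_tendsto_energy (m := m) (by linarith : 0 < α) (by linarith) hφ
    (by rw [hlap]; exact hμc.mul_left) hM hdec
  obtain ⟨r, hr⟩ := huc.isCompact.isBounded.subset_closedBall 0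
  have key : ∀ᶠ R in Filter.atTop, ∫ x, lap^[m] φ x * ∑ j, u x j * pd j φ x ≤
      (C + 1) * N * ∫ x, lap^[m] (ψ R) x * ψ R x := by
    filter_upwards [Filter.eventually_gt_atTop r, Filter.eventually_gt_atTop 0] with R hRr hR
    obtain ⟨hs, hcs, he⟩ := hψ R hR
    have heq : ∀ x, lap^[m] φ x * ∑ j, u x j * pd j φ x =
        lap^[m] (ψ R) x * ∑ j, u x j * pd j (ψ R) x := fun x => by
      by_cases hx : u x = 0
      · simp [hx]
      · have hxr := hr (subset_tsupport u hx)
        rw [mem_closedBall_zero_iff] at hxr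
        have hex := he x (hxr.trans_lt hRr)
        simp only [(hex.iterate_lap m).eq_of_nhds, fun j => (hex.pd j).eq_of_nhds]
    simp only [heq]
    refine (le_abs_self _).trans ((hmain u hu huc (ψ R) hs hcs).trans ?_)
    gcongr
    · exact integral_iterate_lap_mul_self_nonneg hs hcs m
    · linarith
  have hfin := ge_of_tendsto (hlim.const_mul ((C + 1) * N)) key
  simp only [hlap, mul_assoc c, integral_const_mul] at hfin
  refine le_of_mul_le_mul_left (hfin.trans (le_of_eq ?_)) hc
  ring
end
end

section
/- Let d ≥ 3, α ∈ (max(0, d-4), d-2), and γ = α + 3 - d ∈ (-1,1). There exists a constant c > 0 depending only on α and d such that for every μ ∈ C_c^∞(ℝ^d;ℝ), the interaction energy has the extension representation ∬_{ℝ^d×ℝ^d} μ(x) μ(y) |x-y|^{-α} dx dy = c ∬_{ℝ^d×(0,∞)} ξ^γ |Δ_γ 𝒦_{μ,α}(x,ξ)|² dx dξ. -/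
open MeasureTheory

noncomputable section

/-- The operator `Δ_γ f = Δ_{(x,ξ)} f + (γ/ξ) ∂_ξ f` on functions on `ℝ^d × ℝ`
(relevant on the upper half-space `ξ > 0`). -/
noncomputable def dgamma (d : ℕ) (γ : ℝ)
    (f : EuclideanSpace ℝ (Fin d) × ℝ → ℝ)
    (p : EuclideanSpace ℝ (Fin d) × ℝ) : ℝ :=
  (∑ i : Fin d,
      fderiv ℝ (fun q => fderiv ℝ f q (EuclideanSpace.single i 1, 0)) p
        (EuclideanSpace.single i 1, 0))
    + fderiv ℝ (fun q => fderiv ℝ f q (0, 1)) p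
        ((0 : EuclideanSpace ℝ (Fin d)), (1 : ℝ))
    + γ / p.2 * fderiv ℝ f p ((0 : EuclideanSpace ℝ (Fin d)), (1 : ℝ))

/-- The extended potential `𝒦_{μ,β}(x,ξ) = ∫ |(x-y,ξ)|^{-β} μ(y) dy` on the upper
half-space, where `|(z,ξ)| = (|z|² + ξ²)^{1/2}`. -/
noncomputable def Kext (d : ℕ) (β : ℝ) (μ : EuclideanSpace ℝ (Fin d) → ℝ)
    (p : EuclideanSpace ℝ (Fin d) × ℝ) : ℝ :=
  ∫ y, (‖p.1 - y‖ ^ 2 + p.2 ^ 2) ^ (-β / 2) * μ y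

section Differentiation

variable {d : ℕ}

lemma isOpen_upperHalfSpace :
    IsOpen {p : EuclideanSpace ℝ (Fin d) × ℝ | 0 < p.2} :=
  isOpen_lt continuous_const continuous_snd

lemma continuous_comp_sub_horizontal {F : Type*} [TopologicalSpace F]
    {g : EuclideanSpace ℝ (Fin d) × ℝ → F} (hg : ContinuousOn g {p | 0 < p.2})
    {q : EuclideanSpace ℝ (Fin d) × ℝ} (hq : 0 < q.2) :
    Continuous fun y : EuclideanSpace ℝ (Fin d) => g (q - (y, 0)) :=
  hg.comp_continuous (by fun_prop) (by simp [hq])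

lemma integrable_comp_sub_horizontal {F : Type*} [NormedAddCommGroup F] [NormedSpace ℝ F]
    {g : EuclideanSpace ℝ (Fin d) × ℝ → F} (hg : ContinuousOn g {p | 0 < p.2})
    {μ : EuclideanSpace ℝ (Fin d) → ℝ} (hμ : Continuous μ) (hc : HasCompactSupport μ)
    {q : EuclideanSpace ℝ (Fin d) × ℝ} (hq : 0 < q.2) :
    Integrable fun y : EuclideanSpace ℝ (Fin d) => μ y • g (q - (y, 0)) :=
  (hμ.smul (continuous_comp_sub_horizontal hg hq)).integrable_of_hasCompactSupport hc.smul_right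

lemma hasFDerivAt_integral_horizontal
    {k : EuclideanSpace ℝ (Fin d) × ℝ → ℝ} (hk : ContDiffOn ℝ 1 k {p | 0 < p.2})
    {μ : EuclideanSpace ℝ (Fin d) → ℝ} (hμ : Continuous μ) (hc : HasCompactSupport μ)
    {p : EuclideanSpace ℝ (Fin d) × ℝ} (hp : 0 < p.2) :
    HasFDerivAt (fun q => ∫ y, μ y • k (q - (y, 0)))
      (∫ y, μ y • fderiv ℝ k (p - (y, 0))) p := by
  have hk' : ContinuousOn (fderiv ℝ k) {p | 0 < p.2} :=
    hk.continuousOn_fderiv_of_isOpen isOpen_upperHalfSpace le_rfl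
  have hpos : ∀ q ∈ Metric.closedBall p (p.2 / 2), 0 < q.2 := by
    intro q hq
    have h1 : dist q.2 p.2 ≤ p.2 / 2 := (le_max_right _ _).trans (Metric.mem_closedBall.1 hq)
    rw [Real.dist_eq] at h1
    linarith [(abs_le.1 h1).1]
  obtain ⟨C, hC⟩ := ((isCompact_closedBall p (p.2 / 2)).prod hc.isCompact).exists_bound_of_continuousOn
    (f := fun z : (EuclideanSpace ℝ (Fin d) × ℝ) × EuclideanSpace ℝ (Fin d) =>
      fderiv ℝ k (z.1 - (z.2, 0)))
    (hk'.comp (by fun_prop) (fun z hz => by simpa using hpos z.1 hz.1))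
  refine hasFDerivAt_integral_of_dominated_of_fderiv_le (bound := fun y => |μ y| * C)
    (F' := fun q y => μ y • fderiv ℝ k (q - (y, 0)))
    (Metric.closedBall_mem_nhds p (half_pos hp)) ?_
    (integrable_comp_sub_horizontal hk.continuousOn hμ hc hp)
    (integrable_comp_sub_horizontal hk' hμ hc hp).aestronglyMeasurable
    (Filter.Eventually.of_forall fun y q hq => ?_)
    ((hμ.integrable_of_hasCompactSupport hc).abs.mul_const C)
    (Filter.Eventually.of_forall fun y q hq => ?_)
  · filter_upwards [isOpen_upperHalfSpace.mem_nhds hp] with q hq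
    exact (integrable_comp_sub_horizontal hk.continuousOn hμ hc hq).aestronglyMeasurable
  · rw [norm_smul, Real.norm_eq_abs]
    by_cases hy : y ∈ tsupport μ
    · exact mul_le_mul_of_nonneg_left (hC (q, y) ⟨hq, hy⟩) (abs_nonneg _)
    · simp [image_eq_zero_of_notMem_tsupport hy]
  · have hq' : q - (y, 0) ∈ {p : EuclideanSpace ℝ (Fin d) × ℝ | 0 < p.2} := by
      simpa using hpos q hq
    have h := ((hk.differentiableOn one_ne_zero).differentiableAt
      (isOpen_upperHalfSpace.mem_nhds hq')).hasFDerivAt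
    exact (h.comp q ((hasFDerivAt_id q).sub_const (y, 0))).const_smul (μ y)

lemma fderiv_integral_horizontal
    {k : EuclideanSpace ℝ (Fin d) × ℝ → ℝ} (hk : ContDiffOn ℝ 1 k {p | 0 < p.2})
    {μ : EuclideanSpace ℝ (Fin d) → ℝ} (hμ : Continuous μ) (hc : HasCompactSupport μ)
    {p : EuclideanSpace ℝ (Fin d) × ℝ} (hp : 0 < p.2) (v : EuclideanSpace ℝ (Fin d) × ℝ) :
    fderiv ℝ (fun q => ∫ y, μ y • k (q - (y, 0))) p v
      = ∫ y, μ y • fderiv ℝ k (p - (y, 0)) v := by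
  rw [(hasFDerivAt_integral_horizontal hk hμ hc hp).fderiv, ContinuousLinearMap.integral_apply]
  · rfl
  · exact integrable_comp_sub_horizontal
      (hk.continuousOn_fderiv_of_isOpen isOpen_upperHalfSpace le_rfl) hμ hc hp

lemma contDiffOn_fderiv_apply
    {k : EuclideanSpace ℝ (Fin d) × ℝ → ℝ} (hk : ContDiffOn ℝ 2 k {p | 0 < p.2})
    (v : EuclideanSpace ℝ (Fin d) × ℝ) :
    ContDiffOn ℝ 1 (fun q => fderiv ℝ k q v) {p | 0 < p.2} :=
  (hk.fderiv_of_isOpen isOpen_upperHalfSpace (by norm_num)).clm_apply contDiffOn_const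

lemma fderiv_fderiv_integral_horizontal
    {k : EuclideanSpace ℝ (Fin d) × ℝ → ℝ} (hk : ContDiffOn ℝ 2 k {p | 0 < p.2})
    {μ : EuclideanSpace ℝ (Fin d) → ℝ} (hμ : Continuous μ) (hc : HasCompactSupport μ)
    {p : EuclideanSpace ℝ (Fin d) × ℝ} (hp : 0 < p.2) (v : EuclideanSpace ℝ (Fin d) × ℝ) :
    fderiv ℝ (fun r => fderiv ℝ (fun q => ∫ y, μ y • k (q - (y, 0))) r v) p v
      = ∫ y, μ y • fderiv ℝ (fun r => fderiv ℝ k r v) (p - (y, 0)) v := by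
  have h : (fun r => fderiv ℝ (fun q => ∫ y, μ y • k (q - (y, 0))) r v)
      =ᶠ[nhds p] fun r => ∫ y, μ y • fderiv ℝ k (r - (y, 0)) v := by
    filter_upwards [isOpen_upperHalfSpace.mem_nhds hp] with r hr
    exact fderiv_integral_horizontal (hk.of_le (by norm_num)) hμ hc hr v
  rw [h.fderiv_eq]
  exact fderiv_integral_horizontal (contDiffOn_fderiv_apply hk v) hμ hc hp v

lemma dgamma_integral_horizontal (γ : ℝ)
    {k : EuclideanSpace ℝ (Fin d) × ℝ → ℝ} (hk : ContDiffOn ℝ 2 k {p | 0 < p.2})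
    {μ : EuclideanSpace ℝ (Fin d) → ℝ} (hμ : Continuous μ) (hc : HasCompactSupport μ)
    {p : EuclideanSpace ℝ (Fin d) × ℝ} (hp : 0 < p.2) :
    dgamma d γ (fun q => ∫ y, μ y • k (q - (y, 0))) p
      = ∫ y, μ y • dgamma d γ k (p - (y, 0)) := by
  have hk1 : ContDiffOn ℝ 1 k {p | 0 < p.2} := hk.of_le (by norm_num)
  have hi1 (v : EuclideanSpace ℝ (Fin d) × ℝ) :
      Integrable fun y => μ y • fderiv ℝ k (p - (y, 0)) v :=
    integrable_comp_sub_horizontal (contDiffOn_fderiv_apply hk v).continuousOn hμ hc hp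
  have hi2 (v : EuclideanSpace ℝ (Fin d) × ℝ) :
      Integrable fun y => μ y • fderiv ℝ (fun r => fderiv ℝ k r v) (p - (y, 0)) v :=
    integrable_comp_sub_horizontal
      (((contDiffOn_fderiv_apply hk v).continuousOn_fderiv_of_isOpen
        isOpen_upperHalfSpace le_rfl).clm_apply continuousOn_const) hμ hc hp
  simp only [dgamma, fderiv_fderiv_integral_horizontal hk hμ hc hp,
    fderiv_integral_horizontal hk1 hμ hc hp]
  rw [← integral_finsetSum _ fun i _ => hi2 _, ← integral_const_mul, ← integral_add, ← integral_add]
  · refine integral_congr_ae (Filter.Eventually.of_forall fun y => ?_)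
    simp only [smul_eq_mul, Prod.snd_sub, sub_zero, mul_add, Finset.mul_sum]
    ring
  · exact (integrable_finsetSum _ fun i _ => hi2 _).add (hi2 _)
  · exact (hi1 _).const_mul _
  · exact integrable_finsetSum _ fun i _ => hi2 _
  · exact hi2 _

end Differentiation

section Kernel

variable {d : ℕ}

/-- The kernel `|(z,ξ)|^{-β}` on `ℝ^d × ℝ`. -/
def extKernel (d : ℕ) (β : ℝ) (p : EuclideanSpace ℝ (Fin d) × ℝ) : ℝ :=
  (‖p.1‖ ^ 2 + p.2 ^ 2) ^ (-β / 2)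

lemma sq_add_sq_pos {p : EuclideanSpace ℝ (Fin d) × ℝ} (hp : 0 < p.2) :
    0 < ‖p.1‖ ^ 2 + p.2 ^ 2 := by positivity

lemma contDiffOn_extKernel (β : ℝ) {n : WithTop ℕ∞} :
    ContDiffOn ℝ n (extKernel d β) {p | 0 < p.2} := by
  refine ContDiffOn.rpow_const_of_ne ?_ fun p hp => (sq_add_sq_pos hp).ne'
  exact ((contDiff_fst.norm_sq ℝ).add (contDiff_snd.pow 2)).contDiffOn

lemma Kext_eq (β : ℝ) (μ : EuclideanSpace ℝ (Fin d) → ℝ) :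
    Kext d β μ = fun p => ∫ y, μ y • extKernel d β (p - (y, 0)) := by
  ext p
  simp [Kext, extKernel, mul_comm]

lemma hasFDerivAt_extKernel (β : ℝ) {p : EuclideanSpace ℝ (Fin d) × ℝ} (hp : 0 < p.2) :
    HasFDerivAt (extKernel d β)
      ((-β * extKernel d (β + 2) p) •
        ((innerSL ℝ p.1).comp (ContinuousLinearMap.fst ℝ (EuclideanSpace ℝ (Fin d)) ℝ)
          + p.2 • ContinuousLinearMap.snd ℝ (EuclideanSpace ℝ (Fin d)) ℝ)) p := by
  have h1 : HasFDerivAt (fun q : EuclideanSpace ℝ (Fin d) × ℝ => ‖q.1‖ ^ 2) _ p :=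
    hasFDerivAt_fst.norm_sq
  have h2 : HasFDerivAt (fun q : EuclideanSpace ℝ (Fin d) × ℝ => q.2 ^ 2)
      ((2 * p.2) • ContinuousLinearMap.snd ℝ (EuclideanSpace ℝ (Fin d)) ℝ) p := by
    simpa using (hasFDerivAt_snd (𝕜 := ℝ) (p := p)).pow 2
  refine ((h1.add h2).rpow_const (p := -β / 2)
    (Or.inl (sq_add_sq_pos hp).ne')).congr_fderiv ?_
  have h3 : extKernel d (β + 2) p = (‖p.1‖ ^ 2 + p.2 ^ 2) ^ (-β / 2 - 1) := by
    rw [extKernel]; congr 1; ring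
  rw [h3]
  ext v <;> simp <;> ring

lemma fderiv_extKernel_apply (β : ℝ) {p : EuclideanSpace ℝ (Fin d) × ℝ} (hp : 0 < p.2)
    (v : EuclideanSpace ℝ (Fin d) × ℝ) :
    fderiv ℝ (extKernel d β) p v
      = -β * extKernel d (β + 2) p * (inner ℝ p.1 v.1 + p.2 * v.2) := by
  simp [(hasFDerivAt_extKernel β hp).fderiv]
  ring

lemma fderiv_fderiv_extKernel_apply (β : ℝ) {p : EuclideanSpace ℝ (Fin d) × ℝ} (hp : 0 < p.2)
    (v : EuclideanSpace ℝ (Fin d) × ℝ) :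
    fderiv ℝ (fun q => fderiv ℝ (extKernel d β) q v) p v
      = -β * (extKernel d (β + 2) p * (‖v.1‖ ^ 2 + v.2 ^ 2)
        - (β + 2) * extKernel d (β + 4) p * (inner ℝ p.1 v.1 + p.2 * v.2) ^ 2) := by
  have h : (fun q => fderiv ℝ (extKernel d β) q v) =ᶠ[nhds p]
      fun q => -β * extKernel d (β + 2) q * (inner ℝ q.1 v.1 + q.2 * v.2) := by
    filter_upwards [isOpen_upperHalfSpace.mem_nhds hp] with q hq
    exact fderiv_extKernel_apply β hq v
  have h1 : HasFDerivAt (fun q : EuclideanSpace ℝ (Fin d) × ℝ => inner ℝ q.1 v.1 + q.2 * v.2)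
      ((innerSL ℝ v.1).comp (ContinuousLinearMap.fst ℝ (EuclideanSpace ℝ (Fin d)) ℝ)
        + v.2 • ContinuousLinearMap.snd ℝ (EuclideanSpace ℝ (Fin d)) ℝ) p := by
    refine ((innerSL ℝ v.1).comp (ContinuousLinearMap.fst ℝ (EuclideanSpace ℝ (Fin d)) ℝ)
        + v.2 • ContinuousLinearMap.snd ℝ (EuclideanSpace ℝ (Fin d)) ℝ).hasFDerivAt.congr_of_eventuallyEq
      (Filter.Eventually.of_forall fun q => ?_)
    simp [real_inner_comm, mul_comm]
  rw [h.fderiv_eq, HasFDerivAt.fderiv (f := fun q => -β * extKernel d (β + 2) q *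
    (inner ℝ q.1 v.1 + q.2 * v.2)) (((hasFDerivAt_extKernel (β + 2) hp).const_mul (-β)).mul h1)]
  have h4 : β + 2 + 2 = β + 4 := by ring
  simp only [h4, add_apply, smul_apply,
    ContinuousLinearMap.comp_apply, ContinuousLinearMap.coe_fst', ContinuousLinearMap.coe_snd',
    innerSL_apply_apply, smul_eq_mul, real_inner_self_eq_norm_sq]
  ring

lemma sq_add_sq_mul_extKernel (β : ℝ) {p : EuclideanSpace ℝ (Fin d) × ℝ} (hp : 0 < p.2) :
    (‖p.1‖ ^ 2 + p.2 ^ 2) * extKernel d (β + 2) p = extKernel d β p := by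
  rw [extKernel, extKernel, mul_comm, ← Real.rpow_add_one (sq_add_sq_pos hp).ne']
  congr 1
  ring

lemma dgamma_extKernel (β γ : ℝ) {p : EuclideanSpace ℝ (Fin d) × ℝ} (hp : 0 < p.2) :
    dgamma d γ (extKernel d β) p = -β * (d + γ - 1 - β) * extKernel d (β + 2) p := by
  have h := sq_add_sq_mul_extKernel (β + 2) hp
  have h4 : β + 2 + 2 = β + 4 := by ring
  rw [h4, EuclideanSpace.norm_sq_eq] at h
  simp only [dgamma, fderiv_fderiv_extKernel_apply β hp, fderiv_extKernel_apply β hp]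
  simp only [Real.norm_eq_abs, sq_abs] at h
  simp only [EuclideanSpace.inner_single_right, mul_sub, Finset.sum_sub_distrib]
  have h5 : p.2 ≠ 0 := hp.ne'
  simp [← Finset.mul_sum]
  field_simp
  rw [← h]
  ring

lemma dgamma_Kext (β γ : ℝ)
    {μ : EuclideanSpace ℝ (Fin d) → ℝ} (hμ : Continuous μ) (hc : HasCompactSupport μ)
    {p : EuclideanSpace ℝ (Fin d) × ℝ} (hp : 0 < p.2) :
    dgamma d γ (Kext d β μ) p = -β * (d + γ - 1 - β) * Kext d (β + 2) μ p := by
  rw [Kext_eq, Kext_eq, dgamma_integral_horizontal γ (contDiffOn_extKernel β) hμ hc hp,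
    ← integral_const_mul]
  refine integral_congr_ae (Filter.Eventually.of_forall fun y => ?_)
  have hp' : 0 < (p - (y, (0 : ℝ))).2 := by simpa using hp
  simp only [dgamma_extKernel β γ hp', smul_eq_mul]
  ring

end Kernel

section Integrability

variable {d : ℕ}

lemma integrableOn_rpow_mul_max_rpow {a b δ : ℝ} (ha : -1 < a) (hab : a + 1 < b) (hδ : 0 < δ) :
    IntegrableOn (fun r : ℝ => r ^ a * max r δ ^ (-b)) (Set.Ioi 0) := by
  rw [← Set.Ioc_union_Ioi_eq_Ioi hδ.le]
  refine IntegrableOn.union ?_ ?_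
  · have h : IntegrableOn (fun r : ℝ => r ^ a * δ ^ (-b)) (Set.Ioc 0 δ) :=
      ((intervalIntegrable_iff_integrableOn_Ioc_of_le hδ.le).1
        (intervalIntegral.intervalIntegrable_rpow' ha)).mul_const _
    refine h.congr_fun (fun r hr => ?_) measurableSet_Ioc
    simp only [max_eq_right hr.2]
  · refine (integrableOn_Ioi_rpow_of_lt (a := a - b) (by linarith) hδ).congr_fun
      (fun r hr => ?_) measurableSet_Ioi
    have hr : δ < r := hr
    simp only [max_eq_left hr.le, sub_eq_add_neg, Real.rpow_add (hδ.trans hr)]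

lemma integrable_norm_rpow_mul_max_rpow (hd : 0 < d) {s b δ : ℝ} (hs : s < d)
    (hb : d - s < b) (hδ : 0 < δ) :
    Integrable fun x : EuclideanSpace ℝ (Fin d) => ‖x‖ ^ (-s) * max ‖x‖ δ ^ (-b) := by
  have : Nonempty (Fin d) := ⟨⟨0, hd⟩⟩
  refine (integrable_fun_norm_addHaar volume (f := fun r : ℝ => r ^ (-s) * max r δ ^ (-b))).2 ?_
  refine (integrableOn_rpow_mul_max_rpow (a := d - 1 - s) (b := b) (by linarith)
    (by linarith) hδ).congr_fun (fun r hr => ?_) measurableSet_Ioi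
  have hr : 0 < r := hr
  simp only [finrank_euclideanSpace, Fintype.card_fin, smul_eq_mul, ← mul_assoc]
  rw [← Real.rpow_natCast, ← Real.rpow_add hr, Nat.cast_sub (by omega), Nat.cast_one]
  congr 2

lemma volume_restrict_upperHalfSpace :
    (volume : Measure (EuclideanSpace ℝ (Fin d) × ℝ)).restrict {p | 0 < p.2}
      = (volume : Measure (EuclideanSpace ℝ (Fin d))).prod
          ((volume : Measure ℝ).restrict (Set.Ioi 0)) := by
  have h : {p : EuclideanSpace ℝ (Fin d) × ℝ | 0 < p.2} = Set.univ ×ˢ Set.Ioi 0 := by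
    ext p; simp
  rw [h, Measure.volume_eq_prod, ← Measure.prod_restrict, Measure.restrict_univ]

lemma measurable_extKernel (s : ℝ) : Measurable (extKernel d s) := by
  unfold extKernel
  fun_prop

lemma extKernel_nonneg (s : ℝ) (p : EuclideanSpace ℝ (Fin d) × ℝ) : 0 ≤ extKernel d s p := by
  unfold extKernel
  positivity

lemma extKernel_pos (s : ℝ) {p : EuclideanSpace ℝ (Fin d) × ℝ} (hp : 0 < p.2) :
    0 < extKernel d s p :=
  Real.rpow_pos_of_pos (sq_add_sq_pos hp) _

lemma rpow_neg_half_le {N a s : ℝ} (ha : 0 < a) (hN : a ^ 2 ≤ N) (hs : 0 ≤ s) :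
    N ^ (-s / 2) ≤ a ^ (-s) := by
  calc N ^ (-s / 2) ≤ (a ^ 2) ^ (-s / 2) :=
        Real.rpow_le_rpow_of_nonpos (by positivity) hN (by linarith)
    _ = a ^ (-s) := by
        rw [← Real.rpow_natCast, ← Real.rpow_mul ha.le]
        congr 1
        push_cast
        ring

lemma extKernel_mul_extKernel_le {s b c δ ξ : ℝ} {x w : EuclideanSpace ℝ (Fin d)}
    (hb : 0 ≤ b) (hc : 0 ≤ c) (hs : b + c = s) (hδ : 0 < δ) (hξ : 0 < ξ) (hx : x ≠ 0)
    (hxw : ‖x‖ ≤ ‖w‖) (hδw : δ ≤ ‖w‖) :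
    extKernel d s (x, ξ) * extKernel d s (w, ξ)
      ≤ (‖x‖ ^ (-s) * max ‖x‖ δ ^ (-b)) * max ξ δ ^ (-c) := by
  have hx' : 0 < ‖x‖ := norm_pos_iff.2 hx
  have h1 : extKernel d s (x, ξ) ≤ ‖x‖ ^ (-s) :=
    rpow_neg_half_le hx' (by simp [sq_nonneg]) (by linarith)
  have hN : 0 < ‖w‖ ^ 2 + ξ ^ 2 := by positivity
  have h2 : extKernel d s (w, ξ)
      = (‖w‖ ^ 2 + ξ ^ 2) ^ (-b / 2) * (‖w‖ ^ 2 + ξ ^ 2) ^ (-c / 2) := by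
    rw [← Real.rpow_add hN, extKernel]
    congr 1
    linarith
  have h3 : (‖w‖ ^ 2 + ξ ^ 2) ^ (-b / 2) ≤ max ‖x‖ δ ^ (-b) := by
    refine rpow_neg_half_le (by positivity) ?_ hb
    have : max ‖x‖ δ ^ 2 ≤ ‖w‖ ^ 2 := pow_le_pow_left₀ (by positivity) (max_le hxw hδw) 2
    nlinarith [sq_nonneg ξ]
  have h4 : (‖w‖ ^ 2 + ξ ^ 2) ^ (-c / 2) ≤ max ξ δ ^ (-c) := by
    refine rpow_neg_half_le (by positivity) ?_ hc
    rcases max_choice ξ δ with h | h <;> rw [h]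
    · nlinarith [sq_nonneg ‖w‖]
    · nlinarith [sq_nonneg ξ]
  rw [h2, mul_assoc]
  gcongr

/-- The weighted product of two kernels with poles at `0` and `(z,0)`. -/
def weightedKernel (d : ℕ) (s γ : ℝ) (z : EuclideanSpace ℝ (Fin d))
    (p : EuclideanSpace ℝ (Fin d) × ℝ) : ℝ :=
  p.2 ^ γ * (extKernel d s p * extKernel d s (p - (z, 0)))

lemma weightedKernel_pos (s γ : ℝ) (z : EuclideanSpace ℝ (Fin d))
    {p : EuclideanSpace ℝ (Fin d) × ℝ} (hp : 0 < p.2) : 0 < weightedKernel d s γ z p :=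
  mul_pos (Real.rpow_pos_of_pos hp _)
    (mul_pos (extKernel_pos s hp) (extKernel_pos s (by simpa using hp)))

lemma measurable_weightedKernel (s γ : ℝ) (z : EuclideanSpace ℝ (Fin d)) :
    Measurable (weightedKernel d s γ z) :=
  (measurable_snd.pow_const γ).mul ((measurable_extKernel s).mul
    ((measurable_extKernel s).comp (measurable_id.sub_const _)))

lemma integrableOn_weightedKernel (hd : 0 < d) {s γ b c : ℝ} (hγ : -1 < γ) (hsd : s < d)
    (hb : d - s < b) (hc : γ + 1 < c) (hbc : b + c = s)
    {z : EuclideanSpace ℝ (Fin d)} (hz : z ≠ 0) :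
    IntegrableOn (weightedKernel d s γ z) {p | 0 < p.2} := by
  have : Nonempty (Fin d) := ⟨⟨0, hd⟩⟩
  have hz' : 0 < ‖z‖ := norm_pos_iff.2 hz
  have hδ : 0 < ‖z‖ / 2 := by positivity
  set f : EuclideanSpace ℝ (Fin d) → ℝ := fun x => ‖x‖ ^ (-s) * max ‖x‖ (‖z‖ / 2) ^ (-b) with hf_def
  set g : ℝ → ℝ := fun ξ => ξ ^ γ * max ξ (‖z‖ / 2) ^ (-c) with hg_def
  have hf : Integrable f := integrable_norm_rpow_mul_max_rpow hd hsd hb hδ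
  have hg : IntegrableOn g (Set.Ioi 0) := integrableOn_rpow_mul_max_rpow hγ hc hδ
  have hb0 : 0 ≤ b := by linarith
  have hc0 : 0 ≤ c := by linarith
  have hae : ∀ᵐ p : EuclideanSpace ℝ (Fin d) × ℝ ∂volume.restrict {p | 0 < p.2},
      p.1 ≠ 0 ∧ p.1 - z ≠ 0 := by
    rw [volume_restrict_upperHalfSpace]
    refine Measure.quasiMeasurePreserving_fst.ae (p := fun x => x ≠ 0 ∧ x - z ≠ 0) ?_
    filter_upwards [Measure.ae_ne volume (0 : EuclideanSpace ℝ (Fin d)),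
      Measure.ae_ne volume z] with x h1 h2
    exact ⟨h1, sub_ne_zero.2 h2⟩
  have hint : IntegrableOn (fun p : EuclideanSpace ℝ (Fin d) × ℝ =>
      (f p.1 + f (p.1 - z)) * g p.2) {p | 0 < p.2} := by
    rw [IntegrableOn, volume_restrict_upperHalfSpace]
    exact (hf.add (hf.comp_sub_right z)).mul_prod hg
  refine hint.mono' (measurable_weightedKernel s γ z).aestronglyMeasurable ?_
  filter_upwards [hae, ae_restrict_mem isOpen_upperHalfSpace.measurableSet] with p hp hpos
  have hpos : 0 < p.2 := hpos
  rw [Real.norm_of_nonneg (weightedKernel_pos s γ z hpos).le]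
  have hf0 (x : EuclideanSpace ℝ (Fin d)) : 0 ≤ f x := by positivity
  have hm0 : 0 ≤ max p.2 (‖z‖ / 2) ^ (-c) := by positivity
  have hsum : ‖z‖ ≤ ‖p.1‖ + ‖p.1 - z‖ := by
    simpa using norm_sub_le p.1 (p.1 - z)
  have key : extKernel d s p * extKernel d s (p - (z, 0))
      ≤ (f p.1 + f (p.1 - z)) * max p.2 (‖z‖ / 2) ^ (-c) := by
    have e : p - (z, 0) = (p.1 - z, p.2) := by ext1 <;> simp
    rw [e]
    rcases le_total ‖p.1‖ ‖p.1 - z‖ with h | h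
    · refine (extKernel_mul_extKernel_le hb0 hc0 hbc hδ hpos hp.1 h (by linarith)).trans ?_
      exact mul_le_mul_of_nonneg_right (le_add_of_nonneg_right (hf0 _)) hm0
    · rw [mul_comm]
      refine (extKernel_mul_extKernel_le hb0 hc0 hbc hδ hpos hp.2 h (by linarith)).trans ?_
      exact mul_le_mul_of_nonneg_right (le_add_of_nonneg_left (hf0 _)) hm0
  calc weightedKernel d s γ z p
      ≤ p.2 ^ γ * ((f p.1 + f (p.1 - z)) * max p.2 (‖z‖ / 2) ^ (-c)) :=
        mul_le_mul_of_nonneg_left key (by positivity)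
    _ = (f p.1 + f (p.1 - z)) * g p.2 := by rw [hg_def]; ring

lemma integrable_mul_mul_norm_sub_rpow (hd : 0 < d) {a : ℝ} (ha : 0 < a) (had : a < d)
    {μ : EuclideanSpace ℝ (Fin d) → ℝ} (hμ : Continuous μ) (hc : HasCompactSupport μ) :
    Integrable (fun z : EuclideanSpace ℝ (Fin d) × EuclideanSpace ℝ (Fin d) =>
      μ z.1 * μ z.2 * ‖z.1 - z.2‖ ^ (-a)) (volume.prod volume) := by
  set m : EuclideanSpace ℝ (Fin d) → ℝ := fun x => max ‖x‖ 1 with hm_def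
  have hm (x) : 0 < m x := by positivity
  have hmc : Continuous m := by fun_prop
  obtain ⟨C, hC⟩ := (hc.isCompact.prod hc.isCompact).exists_bound_of_continuousOn
    (f := fun z : EuclideanSpace ℝ (Fin d) × EuclideanSpace ℝ (Fin d) =>
      μ z.1 * m (z.1 - z.2) ^ (d : ℝ))
    ((hμ.comp continuous_fst).mul ((hmc.comp (continuous_fst.sub continuous_snd)).rpow_const
      fun z => Or.inl (hm _).ne')).continuousOn
  have h1 : Integrable (fun z : EuclideanSpace ℝ (Fin d) × EuclideanSpace ℝ (Fin d) =>
      |μ z.2| * (‖z.1 - z.2‖ ^ (-a) * m (z.1 - z.2) ^ (-(d : ℝ)) * |C|)) (volume.prod volume) :=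
    (hμ.integrable_of_hasCompactSupport hc).abs.convolution_integrand (ContinuousLinearMap.mul ℝ ℝ)
      ((integrable_norm_rpow_mul_max_rpow hd had (by linarith) one_pos).mul_const |C|)
  have hmeas : Measurable fun z : EuclideanSpace ℝ (Fin d) × EuclideanSpace ℝ (Fin d) =>
      μ z.1 * μ z.2 * ‖z.1 - z.2‖ ^ (-a) :=
    ((hμ.measurable.comp measurable_fst).mul (hμ.measurable.comp measurable_snd)).mul
      ((measurable_fst.sub measurable_snd).norm.pow_const _)
  refine h1.mono' hmeas.aestronglyMeasurable (Filter.Eventually.of_forall fun z => ?_)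
  have hr : 0 ≤ ‖z.1 - z.2‖ ^ (-a) := by positivity
  by_cases hz : z.1 ∈ tsupport μ ∧ z.2 ∈ tsupport μ
  · have h2 : |μ z.1| * m (z.1 - z.2) ^ (d : ℝ) ≤ |C| := by
      have h := (hC z hz).trans (le_abs_self C)
      rwa [norm_mul, Real.norm_eq_abs, Real.norm_of_nonneg (Real.rpow_nonneg (hm _).le _)] at h
    have h3 : m (z.1 - z.2) ^ (d : ℝ) * m (z.1 - z.2) ^ (-(d : ℝ)) = 1 := by
      rw [← Real.rpow_add (hm _)]; simp
    have h4 : |μ z.1| ≤ m (z.1 - z.2) ^ (-(d : ℝ)) * |C| := by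
      calc |μ z.1| = m (z.1 - z.2) ^ (-(d : ℝ)) * (|μ z.1| * m (z.1 - z.2) ^ (d : ℝ)) := by
            linear_combination (-|μ z.1|) * h3
        _ ≤ _ := mul_le_mul_of_nonneg_left h2 (Real.rpow_nonneg (hm _).le _)
    rw [norm_mul, norm_mul, Real.norm_eq_abs, Real.norm_eq_abs, Real.norm_of_nonneg hr]
    calc |μ z.1| * |μ z.2| * ‖z.1 - z.2‖ ^ (-a)
        = |μ z.1| * (|μ z.2| * ‖z.1 - z.2‖ ^ (-a)) := by ring
      _ ≤ (m (z.1 - z.2) ^ (-(d : ℝ)) * |C|) * (|μ z.2| * ‖z.1 - z.2‖ ^ (-a)) := by gcongr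
      _ = _ := by ring
  · have h5 : μ z.1 * μ z.2 = 0 := by
      by_contra h
      exact hz ⟨subset_tsupport _ (left_ne_zero_of_mul h), subset_tsupport _ (right_ne_zero_of_mul h)⟩
    rw [h5, zero_mul, norm_zero]
    exact mul_nonneg (abs_nonneg _)
      (mul_nonneg (mul_nonneg hr (Real.rpow_nonneg (hm _).le _)) (abs_nonneg _))

end Integrability

section Homogeneity

open scoped Pointwise

variable {d : ℕ}

lemma measurePreserving_sub_horizontal (y : EuclideanSpace ℝ (Fin d)) :
    MeasurePreserving (fun p : EuclideanSpace ℝ (Fin d) × ℝ => p - (y, 0))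
      (volume.restrict {p | 0 < p.2}) (volume.restrict {p | 0 < p.2}) := by
  rw [volume_restrict_upperHalfSpace]
  have h := (measurePreserving_sub_right volume y).prod
    (MeasurePreserving.id ((volume : Measure ℝ).restrict (Set.Ioi 0)))
  have he : (fun p : EuclideanSpace ℝ (Fin d) × ℝ => p - (y, 0))
      = Prod.map (fun x => x - y) id := by
    funext p
    ext1 <;> simp
  rw [he]
  exact h

lemma integral_weightedKernel_map (s γ : ℝ) (z : EuclideanSpace ℝ (Fin d))
    (T : EuclideanSpace ℝ (Fin d) ≃ₗᵢ[ℝ] EuclideanSpace ℝ (Fin d)) :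
    ∫ p in {p | 0 < p.2}, weightedKernel d s γ (T z) p
      = ∫ p in {p | 0 < p.2}, weightedKernel d s γ z p := by
  have hT : MeasurePreserving
      (Prod.map T id : EuclideanSpace ℝ (Fin d) × ℝ → EuclideanSpace ℝ (Fin d) × ℝ)
      (volume.restrict {p | 0 < p.2}) (volume.restrict {p | 0 < p.2}) := by
    rw [volume_restrict_upperHalfSpace]
    exact T.measurePreserving.prod (MeasurePreserving.id _)
  have he : MeasurableEmbedding
      (Prod.map T id : EuclideanSpace ℝ (Fin d) × ℝ → EuclideanSpace ℝ (Fin d) × ℝ) :=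
    (T.toHomeomorph.prodCongr (Homeomorph.refl ℝ)).measurableEmbedding
  rw [← hT.integral_comp he]
  refine integral_congr_ae (Filter.Eventually.of_forall fun p => ?_)
  simp [weightedKernel, extKernel, ← map_sub]

lemma extKernel_smul (s : ℝ) {R : ℝ} (hR : 0 < R) (p : EuclideanSpace ℝ (Fin d) × ℝ) :
    extKernel d s (R • p) = R ^ (-s) * extKernel d s p := by
  have h : ‖(R • p).1‖ ^ 2 + (R • p).2 ^ 2 = R ^ 2 * (‖p.1‖ ^ 2 + p.2 ^ 2) := by
    simp only [Prod.smul_fst, Prod.smul_snd, norm_smul, smul_eq_mul, Real.norm_eq_abs,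
      mul_pow, sq_abs]
    ring
  rw [extKernel, extKernel, h, Real.mul_rpow (by positivity) (by positivity),
    ← Real.rpow_natCast, ← Real.rpow_mul hR.le]
  congr 2
  push_cast
  ring

lemma weightedKernel_smul (s γ : ℝ) {R : ℝ} (hR : 0 < R) (z : EuclideanSpace ℝ (Fin d))
    {p : EuclideanSpace ℝ (Fin d) × ℝ} (hp : 0 < p.2) :
    weightedKernel d s γ (R • z) (R • p) = R ^ (γ - 2 * s) * weightedKernel d s γ z p := by
  have h : R • p - (R • z, 0) = R • (p - (z, 0)) := by simp [smul_sub]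
  have h2 : R ^ (γ - 2 * s) = R ^ γ * R ^ (-s) * R ^ (-s) := by
    rw [← Real.rpow_add hR, ← Real.rpow_add hR]
    congr 1
    ring
  rw [weightedKernel, weightedKernel, h, extKernel_smul s hR, extKernel_smul s hR, Prod.smul_snd,
    smul_eq_mul, Real.mul_rpow hR.le hp.le, h2]
  ring

lemma integral_weightedKernel_smul (s γ : ℝ) {R : ℝ} (hR : 0 < R)
    (z : EuclideanSpace ℝ (Fin d)) :
    ∫ p in {p | 0 < p.2}, weightedKernel d s γ (R • z) p
      = R ^ (d + 1 + γ - 2 * s) * ∫ p in {p | 0 < p.2}, weightedKernel d s γ z p := by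
  have : (volume : Measure (EuclideanSpace ℝ (Fin d) × ℝ)).IsAddHaarMeasure :=
    inferInstanceAs ((volume : Measure (EuclideanSpace ℝ (Fin d))).prod
      (volume : Measure ℝ)).IsAddHaarMeasure
  have hU : R • {p : EuclideanSpace ℝ (Fin d) × ℝ | 0 < p.2} = {p | 0 < p.2} := by
    rw [← Set.preimage_smul_inv₀ hR.ne']
    ext p
    simp [hR]
  have h := Measure.setIntegral_comp_smul_of_pos volume (weightedKernel d s γ (R • z))
    {p : EuclideanSpace ℝ (Fin d) × ℝ | 0 < p.2} hR
  rw [hU, setIntegral_congr_fun isOpen_upperHalfSpace.measurableSet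
    (fun p hp => weightedKernel_smul s γ hR z hp), integral_const_mul] at h
  simp only [Module.finrank_prod, finrank_euclideanSpace, Fintype.card_fin, Module.finrank_self,
    smul_eq_mul] at h
  have hpow : R ^ ((d : ℝ) + 1 + γ - 2 * s) = R ^ (d + 1) * R ^ (γ - 2 * s) := by
    rw [← Real.rpow_natCast, ← Real.rpow_add hR]
    congr 1
    push_cast
    ring
  rw [hpow, mul_assoc, h, mul_inv_cancel_left₀ (by positivity)]

lemma integral_weightedKernel_eq (s γ : ℝ) {e z : EuclideanSpace ℝ (Fin d)} (he : ‖e‖ = 1)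
    (hz : z ≠ 0) :
    ∫ p in {p | 0 < p.2}, weightedKernel d s γ z p
      = ‖z‖ ^ (d + 1 + γ - 2 * s) * ∫ p in {p | 0 < p.2}, weightedKernel d s γ e p := by
  have hz' : 0 < ‖z‖ := norm_pos_iff.2 hz
  have hn : ‖e‖ = ‖‖z‖⁻¹ • z‖ := by
    rw [he, norm_smul, norm_inv, norm_norm, inv_mul_cancel₀ hz'.ne']
  have h := integral_weightedKernel_map s γ e (ℝ ∙ (e - ‖z‖⁻¹ • z))ᗮ.reflection
  rw [Submodule.reflection_sub hn] at h
  rw [← h, ← integral_weightedKernel_smul s γ hz', smul_inv_smul₀ hz'.ne']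

end Homogeneity

section Energy

variable {d : ℕ}

lemma setIntegral_rpow_mul_Kext_sq (hd : 0 < d) {s γ b c a : ℝ} (hγ : -1 < γ) (hsd : s < d)
    (hb : d - s < b) (hc : γ + 1 < c) (hbc : b + c = s) (ha : -a = d + 1 + γ - 2 * s)
    (ha0 : 0 < a) (had : a < d) {e : EuclideanSpace ℝ (Fin d)} (he : ‖e‖ = 1)
    {μ : EuclideanSpace ℝ (Fin d) → ℝ} (hμ : Continuous μ) (hμc : HasCompactSupport μ) :
    ∫ p in {p : EuclideanSpace ℝ (Fin d) × ℝ | 0 < p.2}, p.2 ^ γ * Kext d s μ p ^ 2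
      = (∫ p in {p | 0 < p.2}, weightedKernel d s γ e p)
        * ∫ x, ∫ y, μ x * μ y * ‖x - y‖ ^ (-a) := by
  set J := ∫ p in {p | 0 < p.2}, weightedKernel d s γ e p with hJ
  set ν : Measure (EuclideanSpace ℝ (Fin d) × ℝ) := volume.restrict {p | 0 < p.2} with hν
  set H : EuclideanSpace ℝ (Fin d) × ℝ → EuclideanSpace ℝ (Fin d) × EuclideanSpace ℝ (Fin d) → ℝ :=
    fun p y => p.2 ^ γ * ((μ y.1 • extKernel d s (p - (y.1, 0)))
      * (μ y.2 • extKernel d s (p - (y.2, 0)))) with hH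
  have hHW (p) (y : EuclideanSpace ℝ (Fin d) × EuclideanSpace ℝ (Fin d)) :
      H p y = μ y.1 * μ y.2 * weightedKernel d s γ (y.2 - y.1) (p - (y.1, 0)) := by
    have h1 : p - (y.1, 0) - (y.2 - y.1, 0) = p - (y.2, 0) := by ext1 <;> simp
    simp only [hH, weightedKernel, h1, Prod.snd_sub, sub_zero, smul_eq_mul]
    ring
  have hemb (y : EuclideanSpace ℝ (Fin d)) :
      MeasurableEmbedding fun p : EuclideanSpace ℝ (Fin d) × ℝ => p - (y, 0) :=
    (Homeomorph.subRight _).measurableEmbedding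
  have : Nonempty (Fin d) := ⟨⟨0, hd⟩⟩
  have hne : ∀ᵐ y : EuclideanSpace ℝ (Fin d) × EuclideanSpace ℝ (Fin d) ∂volume.prod volume,
      y.2 - y.1 ≠ 0 := by
    filter_upwards [(quasiMeasurePreserving_sub volume volume).ae
      (Measure.ae_ne volume (0 : EuclideanSpace ℝ (Fin d)))] with y hy h
    exact hy (by rw [← neg_sub, h, neg_zero])
  have hnorm : ∀ᵐ y : EuclideanSpace ℝ (Fin d) × EuclideanSpace ℝ (Fin d) ∂volume.prod volume,
      ∫ p, weightedKernel d s γ (y.2 - y.1) (p - (y.1, 0)) ∂ν = ‖y.1 - y.2‖ ^ (-a) * J := by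
    filter_upwards [hne] with y hy
    rw [(measurePreserving_sub_horizontal y.1).integral_comp (hemb y.1),
      integral_weightedKernel_eq s γ he hy, ha, norm_sub_rev]
  have hmeas : Measurable (Function.uncurry H) := by
    have h1 : Measurable (extKernel d s) := measurable_extKernel s
    have h2 : Measurable μ := hμ.measurable
    refine (measurable_fst.snd.pow_const γ).mul (((h2.comp measurable_snd.fst).smul
      (h1.comp ?_)).mul ((h2.comp measurable_snd.snd).smul (h1.comp ?_))) <;> fun_prop
  have hE := integrable_mul_mul_norm_sub_rpow hd ha0 had hμ hμc
  have hint : Integrable (Function.uncurry H) (ν.prod (volume.prod volume)) := by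
    refine (integrable_prod_iff' hmeas.aestronglyMeasurable).2 ⟨?_, ?_⟩
    · filter_upwards [hne] with y hy
      simp only [Function.uncurry, hHW]
      exact ((measurePreserving_sub_horizontal y.1).integrable_comp_of_integrable
        (integrableOn_weightedKernel hd hγ hsd hb hc hbc hy)).const_mul _
    · refine (hE.norm.mul_const J).congr ?_
      filter_upwards [hnorm] with y hy
      have h3 : ∫ p, ‖Function.uncurry H (p, y)‖ ∂ν
          = ∫ p, |μ y.1 * μ y.2| * weightedKernel d s γ (y.2 - y.1) (p - (y.1, 0)) ∂ν := by
        refine setIntegral_congr_fun isOpen_upperHalfSpace.measurableSet fun p hp => ?_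
        have hp' : 0 < (p - (y.1, (0 : ℝ))).2 := by simpa using hp
        simp only [Function.uncurry, hHW]
        rw [norm_mul, Real.norm_eq_abs, Real.norm_of_nonneg (weightedKernel_pos s γ _ hp').le]
      rw [h3, integral_const_mul, hy, norm_mul, Real.norm_eq_abs,
        Real.norm_of_nonneg (by positivity), mul_assoc]
  calc ∫ p, p.2 ^ γ * Kext d s μ p ^ 2 ∂ν
      = ∫ p, ∫ y, H p y ∂(volume.prod volume) ∂ν := by
        congr 1
        ext p
        simp only [hH]
        rw [integral_const_mul, integral_prod_mul (fun y => μ y • extKernel d s (p - (y, 0)))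
          (fun y => μ y • extKernel d s (p - (y, 0))), Kext_eq, sq]
    _ = ∫ y, ∫ p, H p y ∂ν ∂(volume.prod volume) := integral_integral_swap hint
    _ = ∫ y, J * (μ y.1 * μ y.2 * ‖y.1 - y.2‖ ^ (-a)) ∂(volume.prod volume) := by
        refine integral_congr_ae ?_
        filter_upwards [hnorm] with y hy
        simp only [hHW]
        rw [integral_const_mul, hy]
        ring
    _ = J * ∫ x, ∫ y, μ x * μ y * ‖x - y‖ ^ (-a) := by
        rw [integral_const_mul, integral_prod _ hE]

lemma integral_weightedKernel_pos {s γ : ℝ} {z : EuclideanSpace ℝ (Fin d)}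
    (h : IntegrableOn (weightedKernel d s γ z) {p | 0 < p.2}) :
    0 < ∫ p in {p | 0 < p.2}, weightedKernel d s γ z p := by
  have hms := (isOpen_upperHalfSpace (d := d)).measurableSet
  rw [setIntegral_pos_iff_support_of_nonneg_ae _ h]
  · have h1 : {p : EuclideanSpace ℝ (Fin d) × ℝ | 0 < p.2}
        ⊆ Function.support (weightedKernel d s γ z) := fun p hp =>
      (weightedKernel_pos s γ z hp).ne'
    rw [Set.inter_eq_right.2 h1]
    exact isOpen_upperHalfSpace.measure_pos volume ⟨(0, 1), by simp⟩
  · filter_upwards [ae_restrict_mem hms] with p hp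
    exact (weightedKernel_pos s γ z hp).le

end Energy

/-- Extension representation of the interaction energy for
`α ∈ (max(0,d-4), d-2)`, `γ = α + 3 - d`: there is `c > 0` depending only on `α, d`
such that for every `μ ∈ C_c^∞(ℝ^d)`,
`∬ μ(x) μ(y) |x-y|^{-α} dx dy = c ∬_{ℝ^d×(0,∞)} ξ^γ |Δ_γ 𝒦_{μ,α}|² dx dξ`. -/
theorem stmt_6 (d : ℕ) (hd : 3 ≤ d) (α γ : ℝ)
    (hα₁ : max 0 ((d : ℝ) - 4) < α) (hα₂ : α < (d : ℝ) - 2)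
    (hγ : γ = α + 3 - d) :
    ∃ c : ℝ, 0 < c ∧
      ∀ μ : EuclideanSpace ℝ (Fin d) → ℝ,
        ContDiff ℝ (⊤ : ℕ∞) μ → HasCompactSupport μ →
        (∫ x, ∫ y, μ x * μ y * ‖x - y‖ ^ (-α))
          = c * ∫ p in {p : EuclideanSpace ℝ (Fin d) × ℝ | 0 < p.2},
              p.2 ^ γ * (dgamma d γ (Kext d α μ) p) ^ 2 := by
  have hα0 : 0 < α := (le_max_left _ _).trans_lt hα₁
  have hα4 : (d : ℝ) - 4 < α := (le_max_right _ _).trans_lt hα₁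
  have hd0 : 0 < d := by omega
  have hγ1 : -1 < γ := by linarith
  have hsd : α + 2 < d := by linarith
  have hb : (d : ℝ) - (α + 2) < d - α - 2 + α / 2 := by linarith
  have hc : γ + 1 < α + 4 - d + α / 2 := by linarith
  have hbc : (d : ℝ) - α - 2 + α / 2 + (α + 4 - d + α / 2) = α + 2 := by ring
  set e : EuclideanSpace ℝ (Fin d) := EuclideanSpace.single ⟨0, hd0⟩ 1
  have he : ‖e‖ = 1 := by simp [e]
  have he0 : e ≠ 0 := by
    intro h
    simp [h] at he
  have hJ := integral_weightedKernel_pos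
    (integrableOn_weightedKernel hd0 hγ1 hsd hb hc hbc he0)
  refine ⟨(4 * α ^ 2 * ∫ p in {p | 0 < p.2}, weightedKernel d (α + 2) γ e p)⁻¹,
    by positivity, fun μ hμ hμc => ?_⟩
  have hcong : ∫ p in {p : EuclideanSpace ℝ (Fin d) × ℝ | 0 < p.2},
      p.2 ^ γ * (dgamma d γ (Kext d α μ) p) ^ 2
      = 4 * α ^ 2 * ∫ p in {p : EuclideanSpace ℝ (Fin d) × ℝ | 0 < p.2},
        p.2 ^ γ * Kext d (α + 2) μ p ^ 2 := by
    rw [← integral_const_mul]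
    refine setIntegral_congr_fun isOpen_upperHalfSpace.measurableSet fun p hp => ?_
    have hp : 0 < p.2 := hp
    have hc2 : (d : ℝ) + γ - 1 - α = 2 := by rw [hγ]; ring
    simp only [dgamma_Kext α γ hμ.continuous hμc hp, hc2]
    ring
  rw [hcong, setIntegral_rpow_mul_Kext_sq hd0 hγ1 hsd hb hc hbc (a := α) (by rw [hγ]; ring)
    hα0 (by linarith) he hμ.continuous hμc, ← mul_assoc, ← mul_assoc, mul_assoc _ (4 * α ^ 2),
    inv_mul_cancel₀ (by positivity), one_mul]
end
end
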